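/- (Theorem 4: two encoders and three decoders with lossless/lossy constraints, reversal delivery and side information.) In the setting where node 3 sends no messages (R3=0) and the constraints are: node 1 reconstructs X_2^n with distortion target D12, node 2 reconstructs X_1^n losslessly, and node 3 (which observes X_3^n) reconstructs X_2^n losslessly and X_1^n with distortion target D31: a rate pair (R1,R2) is achievable if and only if there exist a finite set 𝒰 with |𝒰| ≤ |𝒳1||𝒳2|+3, a joint pmf p_{X1X2X3U} whose (X1,X2,X3)-marginal equals the source pmf and which satisfies the Markov chain U −∘− (X1,X2) −∘− X3, and maps g31: 𝒳2×𝒳3×𝒰 → X̂1 and g12: 𝒳1×𝒰 → X̂2 with E[d1(X1, g31(X2,X3,U))] ≤ D31 and E[d2(X2, g12(X1,U))] ≤ D12, such that R1 ≥ H(X1|X2), R2 ≥ I(U;X2|X1) + H(X2|U,X1,X3), and R1+R2 ≥ H(X1,X2|X3). -/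

import Mathlib

noncomputable section

namespace IT

variable {Ω : Type*} [Fintype Ω]

open Classical in
/-- Probability of an event under a weight function on a finite sample space. -/
def pr (w : Ω → ℝ) (E : Ω → Prop) : ℝ := ∑ ω, if E ω then w ω else 0

open Classical in
/-- The distribution (pmf) of a random variable. -/
def dist (w : Ω → ℝ) {α : Type*} [Fintype α] (X : Ω → α) (a : α) : ℝ :=
  ∑ ω, if X ω = a then w ω else 0

/-- Shannon entropy (base 2). -/
def H (w : Ω → ℝ) {α : Type*} [Fintype α] (X : Ω → α) : ℝ :=
  -∑ a, dist w X a * Real.logb 2 (dist w X a)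

/-- Conditional entropy H(X|Y). -/
def condH (w : Ω → ℝ) {α β : Type*} [Fintype α] [Fintype β] (X : Ω → α) (Y : Ω → β) : ℝ :=
  H w (fun ω => (X ω, Y ω)) - H w Y

/-- Mutual information I(X;Y). -/
def mutInfo (w : Ω → ℝ) {α β : Type*} [Fintype α] [Fintype β] (X : Ω → α) (Y : Ω → β) : ℝ :=
  H w X + H w Y - H w (fun ω => (X ω, Y ω))

/-- Conditional mutual information I(X;Y|Z). -/
def condMutInfo (w : Ω → ℝ) {α β γ : Type*} [Fintype α] [Fintype β] [Fintype γ]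
    (X : Ω → α) (Y : Ω → β) (Z : Ω → γ) : ℝ :=
  condH w X Z - condH w X (fun ω => (Y ω, Z ω))

/-- Expectation of a real random variable. -/
def expect (w : Ω → ℝ) (f : Ω → ℝ) : ℝ := ∑ ω, w ω * f ω

end IT

/-- `p` is a probability mass function on a finite type. -/
def IsPMF {α : Type*} [Fintype α] (p : α → ℝ) : Prop := (∀ a, 0 ≤ p a) ∧ ∑ a, p a = 1

/-- The i.i.d. (product) weight on `n`-sequences induced by a single-letter pmf. -/
def iidW {α : Type*} (p : α → ℝ) (n : ℕ) : (Fin n → α) → ℝ := fun x => ∏ t, p (x t)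

/-- The first `l` components of a dependent tuple (the rest masked). -/
def trunc {K : ℕ} {γ : Fin K → Type*} (l : ℕ) (f : (k : Fin K) → γ k) :
    (k : Fin K) → Option (γ k) :=
  fun k => if k.val < l then some (f k) else none

/-- Coordinates with (0-based) index `< t`. -/
def below {n : ℕ} {α : Type*} (t : ℕ) (x : Fin n → α) : Fin n → Option α :=
  fun s => if s.val < t then some (x s) else none

/-- Coordinates with (0-based) index `> t`. -/
def above {n : ℕ} {α : Type*} (t : ℕ) (x : Fin n → α) : Fin n → Option α :=
  fun s => if t < s.val then some (x s) else none

/-- Coordinates with (0-based) index `≥ t`. -/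
def fromIdx {n : ℕ} {α : Type*} (t : ℕ) (x : Fin n → α) : Fin n → Option α :=
  fun s => if t ≤ s.val then some (x s) else none

open Classical in
/-- Number of occurrences of `a` in the sequence `x`. -/
def Nocc {n : ℕ} {α : Type*} (a : α) (x : Fin n → α) : ℕ :=
  (Finset.univ.filter fun t => x t = a).card

/-- Strongly typical set. -/
def typical {α : Type*} [Fintype α] (Q : α → ℝ) (δ : ℝ) (n : ℕ) : Set (Fin n → α) :=
  {x | ∀ a, Q a ≠ 0 → |(Nocc a x : ℝ) / n - Q a| ≤ δ / Fintype.card α}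

namespace TE

/-! ### Basic entropy calculus -/

section basic
variable {Ω : Type*} [Fintype Ω] {α β γ : Type*} [Fintype α] [Fintype β] [Fintype γ]

lemma sum_dist_mul (w : Ω → ℝ) (X : Ω → α) (φ : α → ℝ) :
    ∑ a, IT.dist w X a * φ a = ∑ ω, w ω * φ (X ω) := by
  classical
  unfold IT.dist
  simp only [Finset.sum_mul]
  rw [Finset.sum_comm]
  refine Finset.sum_congr rfl fun ω _ => ?_
  simp [ite_mul]

lemma sum_dist (w : Ω → ℝ) (X : Ω → α) : ∑ a, IT.dist w X a = ∑ ω, w ω := by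
  simpa using sum_dist_mul w X (fun _ => 1)

lemma H_eq (w : Ω → ℝ) (X : Ω → α) :
    IT.H w X = ∑ ω, w ω * (-Real.logb 2 (IT.dist w X (X ω))) := by
  unfold IT.H
  rw [sum_dist_mul w X (fun a => Real.logb 2 (IT.dist w X a))]
  simp

lemma dist_nonneg {w : Ω → ℝ} (hw : ∀ ω, 0 ≤ w ω) (X : Ω → α) (a : α) : 0 ≤ IT.dist w X a := by
  unfold IT.dist
  exact Finset.sum_nonneg fun ω _ => by split_ifs <;> simp [hw]

lemma le_dist {w : Ω → ℝ} (hw : ∀ ω, 0 ≤ w ω) (X : Ω → α) (ω : Ω) :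
    w ω ≤ IT.dist w X (X ω) := by
  classical
  unfold IT.dist
  have := Finset.single_le_sum (f := fun ω' => if X ω' = X ω then w ω' else 0)
    (fun i _ => by split_ifs <;> simp [hw]) (Finset.mem_univ ω)
  simpa using this

lemma dist_pos {w : Ω → ℝ} (hw : ∀ ω, 0 ≤ w ω) (X : Ω → α) {ω : Ω} (h : 0 < w ω) :
    0 < IT.dist w X (X ω) := h.trans_le (le_dist hw X ω)

lemma H_congr (w : Ω → ℝ) (X : Ω → α) (Y : Ω → β) (h : ∀ ω ω', X ω = X ω' ↔ Y ω = Y ω') :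
    IT.H w X = IT.H w Y := by
  rw [H_eq, H_eq]
  refine Finset.sum_congr rfl fun ω _ => ?_
  have : IT.dist w X (X ω) = IT.dist w Y (Y ω) := by
    unfold IT.dist
    refine Finset.sum_congr rfl fun ω' _ => ?_
    by_cases h1 : X ω' = X ω
    · rw [if_pos h1, if_pos ((h _ _).1 h1)]
    · rw [if_neg h1, if_neg (fun h2 => h1 ((h _ _).2 h2))]
  rw [this]

/-- Coarser variables have smaller entropy. -/
lemma H_mono {w : Ω → ℝ} (hw : ∀ ω, 0 ≤ w ω) (X : Ω → α) (Y : Ω → β)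
    (h : ∀ ω ω', X ω = X ω' → Y ω = Y ω') : IT.H w Y ≤ IT.H w X := by
  rw [H_eq, H_eq]
  refine Finset.sum_le_sum fun ω _ => ?_
  rcases (hw ω).eq_or_lt with h0 | h0
  · simp [← h0]
  refine mul_le_mul_of_nonneg_left ?_ (hw ω)
  refine neg_le_neg (Real.logb_le_logb_of_le (by norm_num) (dist_pos hw X h0) ?_)
  unfold IT.dist
  refine Finset.sum_le_sum fun ω' _ => ?_
  by_cases h1 : X ω' = X ω
  · simp [h1, h _ _ h1]
  · simp only [h1, if_false]; split_ifs <;> simp [hw]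

/-- The Gibbs inequality in conditional form. -/
lemma condH_le {w : Ω → ℝ} (hw : IsPMF w) (X : Ω → α) (Y : Ω → β) (r : α → β → ℝ)
    (hr0 : ∀ a b, 0 ≤ r a b) (hr1 : ∀ b, ∑ a, r a b ≤ 1)
    (hpos : ∀ ω, 0 < w ω → 0 < r (X ω) (Y ω)) :
    IT.condH w X Y ≤ ∑ ω, w ω * (-Real.logb 2 (r (X ω) (Y ω))) := by
  obtain ⟨hw0, hw1⟩ := hw
  unfold IT.condH
  rw [H_eq, H_eq, ← Finset.sum_sub_distrib, ← sub_nonpos, ← Finset.sum_sub_distrib]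
  set P := IT.dist w (fun ω => (X ω, Y ω)) with hP
  set Q := IT.dist w Y with hQ
  have hl2 : 0 < Real.log 2 := Real.log_pos (by norm_num)
  have key : ∀ ω, w ω * -Real.logb 2 (P (X ω, Y ω)) - w ω * -Real.logb 2 (Q (Y ω)) -
      w ω * -Real.logb 2 (r (X ω) (Y ω)) ≤
      (w ω * (r (X ω) (Y ω) * Q (Y ω) / P (X ω, Y ω)) - w ω) / Real.log 2 := by
    intro ω
    rcases (hw0 ω).eq_or_lt with h0 | h0
    · simp [← h0]
    have hPp : 0 < P (X ω, Y ω) := dist_pos hw0 (fun ω => (X ω, Y ω)) h0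
    have hQp : 0 < Q (Y ω) := dist_pos hw0 Y h0
    have hrp := hpos ω h0
    have := Real.log_le_sub_one_of_pos (show 0 < r (X ω) (Y ω) * Q (Y ω) / P (X ω, Y ω) by positivity)
    rw [Real.log_div (by positivity) (by positivity), Real.log_mul (by positivity) (by positivity)] at this
    rw [le_div_iff₀ hl2]
    unfold Real.logb
    have e : (w ω * -(Real.log (P (X ω, Y ω)) / Real.log 2) - w ω * -(Real.log (Q (Y ω)) / Real.log 2) -
      w ω * -(Real.log (r (X ω) (Y ω)) / Real.log 2)) * Real.log 2 = w ω * (Real.log (r (X ω) (Y ω)) + Real.log (Q (Y ω)) - Real.log (P (X ω, Y ω))) := by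
      field_simp; ring
    rw [e]
    nlinarith
  refine (Finset.sum_le_sum fun ω _ => key ω).trans ?_
  rw [← Finset.sum_div, Finset.sum_sub_distrib, hw1]
  refine div_nonpos_of_nonpos_of_nonneg ?_ hl2.le
  rw [sub_nonpos, ← sum_dist_mul w (fun ω => (X ω, Y ω)) (fun z => r z.1 z.2 * Q z.2 / P z)]
  have h1 : ∀ z : α × β, IT.dist w (fun ω => (X ω, Y ω)) z * (r z.1 z.2 * Q z.2 / P z) ≤ r z.1 z.2 * Q z.2 := by
    intro z
    have hz : 0 ≤ r z.1 z.2 * Q z.2 := mul_nonneg (hr0 _ _) (dist_nonneg hw0 _ _)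
    rw [← hP]
    rcases eq_or_ne (P z) 0 with h | h
    · simp [h, hz]
    · rw [mul_div_cancel₀ _ h]
  refine (Finset.sum_le_sum fun z _ => h1 z).trans ?_
  rw [Fintype.sum_prod_type_right]
  have h2 : ∀ b, ∑ a, r a b * Q b ≤ Q b := by
    intro b
    rw [← Finset.sum_mul]
    exact mul_le_of_le_one_left (dist_nonneg hw0 _ _) (hr1 b)
  refine (Finset.sum_le_sum fun b _ => h2 b).trans ?_
  rw [hQ, sum_dist, hw1]

lemma H_pair_le {w : Ω → ℝ} (hw : IsPMF w) (X : Ω → α) (Y : Ω → β) :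
    IT.H w (fun ω => (X ω, Y ω)) ≤ IT.H w X + IT.H w Y := by
  have := condH_le hw X Y (fun a _ => IT.dist w X a) (fun a _ => dist_nonneg hw.1 _ _)
    (fun _ => by rw [sum_dist, hw.2]) (fun ω h => dist_pos hw.1 X h)
  rw [← H_eq] at this
  unfold IT.condH at this
  linarith

lemma H_le_log_card {w : Ω → ℝ} (hw : IsPMF w) (X : Ω → α) :
    IT.H w X ≤ Real.logb 2 (Fintype.card α) := by
  have hΩ : Nonempty Ω := by
    by_contra h
    rw [not_nonempty_iff] at h
    have := hw.2
    simp at this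
  obtain ⟨ω0⟩ := hΩ
  have hα : Nonempty α := ⟨X ω0⟩
  have hc : (0:ℝ) < Fintype.card α := by exact_mod_cast Fintype.card_pos
  have := condH_le hw X (fun _ => ()) (fun _ _ => 1 / (Fintype.card α : ℝ)) (fun a _ => by positivity)
    (fun _ => by simp) (fun ω h => by positivity)
  have e1 : IT.H w (fun ω => (X ω, ())) = IT.H w X := H_congr _ _ _ (by simp)
  have e2 : IT.H w (fun _ : Ω => ()) = 0 := by
    rw [H_eq]
    have : IT.dist w (fun _ : Ω => ()) () = 1 := by simpa [IT.dist] using hw.2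
    simp [this]
  unfold IT.condH at this
  rw [e1, e2, ← Finset.sum_mul, hw.2] at this
  simpa using this

open Classical in
/-- Fano's inequality. -/
lemma fano {w : Ω → ℝ} (hw : IsPMF w) (X : Ω → α) (Y : Ω → β) (g : β → α) (ε : ℝ)
    (he : 0 < ε) (he1 : ε < 1) (hP : IT.pr w (fun ω => g (Y ω) ≠ X ω) ≤ ε) :
    IT.condH w X Y ≤ -Real.logb 2 (1 - ε) - ε * Real.logb 2 ε + ε * Real.logb 2 (Fintype.card α) := by
  have hΩ : Nonempty Ω := by
    by_contra h
    rw [not_nonempty_iff] at h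
    have := hw.2
    simp at this
  obtain ⟨ω0⟩ := hΩ
  have hα : Nonempty α := ⟨X ω0⟩
  have hc : (0:ℝ) < Fintype.card α := by exact_mod_cast Fintype.card_pos
  have hc1 : (1:ℝ) ≤ Fintype.card α := by exact_mod_cast Fintype.card_pos
  set N : ℝ := (Fintype.card α : ℝ) with hN
  have := condH_le hw X Y (fun a b => if g b = a then 1 - ε else ε / N)
    (fun a b => by split_ifs <;> [linarith; positivity])
    (fun b => by
      have : ∀ a, (if g b = a then 1 - ε else ε / N) ≤ (if g b = a then 1 - ε else 0) + ε / N := by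
        intro a; split_ifs <;> simp; positivity
      refine (Finset.sum_le_sum fun a _ => this a).trans ?_
      rw [Finset.sum_add_distrib]
      simp [← hN]
      field_simp; simp)
    (fun ω h => by split_ifs <;> [linarith; positivity])
  refine this.trans ?_
  have hlog : 0 ≤ -Real.logb 2 (ε / N) := by
    rw [neg_nonneg]
    refine Real.logb_nonpos (by norm_num) (by positivity) ?_
    rw [div_le_one hc]; linarith
  have hlog1 : 0 ≤ -Real.logb 2 (1 - ε) := by
    rw [neg_nonneg]
    exact Real.logb_nonpos (by norm_num) (by linarith) (by linarith)
  have hb : ∀ ω, w ω * (-Real.logb 2 (if g (Y ω) = X ω then 1 - ε else ε / N)) ≤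
      w ω * (-Real.logb 2 (1 - ε)) + (if g (Y ω) ≠ X ω then w ω else 0) * (-Real.logb 2 (ε / N)) := by
    intro ω
    have h0 := hw.1 ω
    by_cases h : g (Y ω) = X ω
    · simp [h]
    · simp only [h, if_false, ne_eq, not_false_eq_true, if_true]
      nlinarith
  refine (Finset.sum_le_sum fun ω _ => hb ω).trans ?_
  rw [Finset.sum_add_distrib, ← Finset.sum_mul, ← Finset.sum_mul, hw.2]
  have : ∑ ω, (if g (Y ω) ≠ X ω then w ω else 0) ≤ ε := by
    refine le_trans (le_of_eq ?_) hP
    unfold IT.pr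
    exact Finset.sum_congr rfl fun ω _ => by congr
  have h3 := mul_le_mul_of_nonneg_right this hlog
  rw [Real.logb_div (by positivity) (by positivity)] at h3 ⊢
  linarith

/-- Subadditivity of conditional entropy over coordinates. -/
lemma condH_pi_le {w : Ω → ℝ} (hw : IsPMF w) {n : ℕ} (X : Fin n → Ω → α) (Y : Ω → β) :
    IT.condH w (fun ω t => X t ω) Y ≤ ∑ t, IT.condH w (X t) Y := by
  classical
  have := condH_le hw (fun ω t => X t ω) Y
    (fun x b => ∏ t, (IT.dist w (fun ω => (X t ω, Y ω)) (x t, b) / IT.dist w Y b))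
    (fun x b => Finset.prod_nonneg fun t _ => div_nonneg (dist_nonneg hw.1 _ _) (dist_nonneg hw.1 _ _))
    (fun b => by
      have := Finset.prod_univ_sum (fun _ : Fin n => (Finset.univ : Finset α))
        (fun t a => IT.dist w (fun ω => (X t ω, Y ω)) (a, b) / IT.dist w Y b)
      rw [Fintype.piFinset_univ] at this
      rw [← this]
      refine Finset.prod_le_one (fun t _ => Finset.sum_nonneg fun a _ => div_nonneg (dist_nonneg hw.1 _ _) (dist_nonneg hw.1 _ _)) fun t _ => ?_
      rw [← Finset.sum_div]
      refine div_le_one_of_le₀ (le_of_eq ?_) (dist_nonneg hw.1 _ _)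
      unfold IT.dist
      rw [Finset.sum_comm]
      refine Finset.sum_congr rfl fun ω _ => ?_
      simp only [Prod.mk.injEq]
      by_cases h : Y ω = b <;> simp [h])
    (fun ω h => Finset.prod_pos fun t _ => div_pos (dist_pos hw.1 (fun ω => (X t ω, Y ω)) h) (dist_pos hw.1 Y h))
  refine this.trans (le_of_eq ?_)
  unfold IT.condH
  simp only [H_eq, ← Finset.sum_sub_distrib]
  rw [Finset.sum_comm]
  refine Finset.sum_congr rfl fun ω _ => ?_
  rcases (hw.1 ω).eq_or_lt with h0 | h0
  · simp [← h0]
  simp only [← mul_sub]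
  rw [← Finset.mul_sum]
  congr 1
  rw [Real.logb_prod _ _ (fun t _ => ne_of_gt (div_pos (dist_pos hw.1 (fun ω => (X t ω, Y ω)) h0) (dist_pos hw.1 Y h0))),
    ← Finset.sum_neg_distrib]
  refine Finset.sum_congr rfl fun t _ => ?_
  rw [Real.logb_div (dist_pos hw.1 (fun ω => (X t ω, Y ω)) h0).ne' (dist_pos hw.1 Y h0).ne']
  ring

/-- Entropy through a pushforward. -/
lemma dist_comp (w : Ω → ℝ) (π : Ω → α) (p : α → ℝ) (h : ∀ a, IT.dist w π a = p a)
    (f : α → β) (b : β) : IT.dist w (fun ω => f (π ω)) b = IT.dist p f b := by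
  classical
  have := sum_dist_mul w π (fun a => if f a = b then 1 else 0)
  simp only [h, mul_ite, mul_one, mul_zero] at this
  unfold IT.dist
  convert this.symm

lemma H_comp (w : Ω → ℝ) (π : Ω → α) (p : α → ℝ) (h : ∀ a, IT.dist w π a = p a)
    (f : α → β) : IT.H w (fun ω => f (π ω)) = IT.H p f := by
  unfold IT.H
  simp only [dist_comp w π p h f]

end basic

/-! ### i.i.d. products -/
section iid
variable {α β : Type*} [Fintype α] [Fintype β]

lemma sum_prod_pi {n : ℕ} (f : Fin n → α → ℝ) :
    ∑ x : Fin n → α, ∏ t, f t (x t) = ∏ t, ∑ a, f t a := by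
  classical
  have := Finset.prod_univ_sum (fun _ : Fin n => (Finset.univ : Finset α)) f
  rw [Fintype.piFinset_univ] at this
  exact this.symm

lemma iid_pmf {p : α → ℝ} (hp : IsPMF p) (n : ℕ) : IsPMF (iidW p n) := by
  refine ⟨fun x => Finset.prod_nonneg fun t _ => hp.1 _, ?_⟩
  unfold iidW
  rw [sum_prod_pi (fun _ a => p a), hp.2]
  simp

lemma dist_iid (p : α → ℝ) (n : ℕ) (f : α → β) (y : Fin n → β) :
    IT.dist (iidW p n) (fun ω t => f (ω t)) y = ∏ t, IT.dist p f (y t) := by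
  classical
  unfold IT.dist iidW
  rw [← sum_prod_pi (fun t a => if f a = y t then p a else 0)]
  refine Finset.sum_congr rfl fun x _ => ?_
  by_cases h : (fun t => f (x t)) = y
  · rw [if_pos h]
    refine Finset.prod_congr rfl fun t _ => ?_
    rw [if_pos (congrFun h t)]
  · rw [if_neg h]
    obtain ⟨t, ht⟩ := Function.ne_iff.mp h
    exact (Finset.prod_eq_zero (Finset.mem_univ t) (if_neg ht)).symm

lemma iid_expect {p : α → ℝ} (hp : IsPMF p) (n : ℕ) (t : Fin n) (φ : α → ℝ) :
    ∑ ω, iidW p n ω * φ (ω t) = ∑ a, p a * φ a := by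
  classical
  unfold iidW
  have : ∀ ω : Fin n → α, (∏ s, p (ω s)) * φ (ω t) = ∏ s, (p (ω s) * if s = t then φ (ω s) else 1) := by
    intro ω
    rw [Finset.prod_mul_distrib]
    simp
  simp only [this]
  rw [sum_prod_pi (fun s a => p a * if s = t then φ a else 1), ← Finset.mul_prod_erase _ _ (Finset.mem_univ t)]
  rw [Finset.prod_eq_one]
  · simp
  · intro s hs
    simp [Finset.ne_of_mem_erase hs, hp.2]

lemma H_iid {p : α → ℝ} (hp : IsPMF p) (n : ℕ) (f : α → β) :
    IT.H (iidW p n) (fun ω t => f (ω t)) = n * IT.H p f := by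
  rw [H_eq, H_eq]
  have : ∀ ω, iidW p n ω * (-Real.logb 2 (IT.dist (iidW p n) (fun ω t => f (ω t)) (fun t => f (ω t))))
      = ∑ t, iidW p n ω * (-Real.logb 2 (IT.dist p f (f (ω t)))) := by
    intro ω
    rw [← Finset.mul_sum]
    by_cases h0 : iidW p n ω = 0
    · simp [h0]
    congr 1
    rw [dist_iid, Real.logb_prod, Finset.sum_neg_distrib]
    intro t _
    refine (dist_pos hp.1 f (lt_of_le_of_ne (hp.1 _) ?_)).ne'
    intro h
    exact h0 (Finset.prod_eq_zero (Finset.mem_univ t) h.symm)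
  simp only [this]
  rw [Finset.sum_comm]
  simp only [iid_expect hp n _ (fun a => -Real.logb 2 (IT.dist p f (f a)))]
  simp

end iid
end TE

namespace TE

/-! ### The multi-letter converse -/
section conv
variable {Ω : Type*} [Fintype Ω] {α β γ ζ : Type*} [Fintype α] [Fintype β] [Fintype γ] [Fintype ζ]

def fanoB (e L : ℝ) : ℝ := -Real.logb 2 (1 - e) - e * Real.logb 2 e + e * L

lemma H_le_of_decode {w : Ω → ℝ} (hw : IsPMF w) (T : Ω → γ) (Z : Ω → ζ) (Y : Ω → β) (g : β → ζ)
    (hT : ∀ ω ω', Z ω = Z ω' → Y ω = Y ω' → T ω = T ω') (e : ℝ)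
    (he : 0 < e) (he1 : e < 1) (hP : IT.pr w (fun ω => g (Y ω) ≠ Z ω) ≤ e) :
    IT.H w T ≤ IT.H w Y + fanoB e (Real.logb 2 (Fintype.card ζ)) := by
  have h1 := fano hw Z Y g e he he1 hP
  have h2 : IT.H w T ≤ IT.H w (fun ω => (Z ω, Y ω)) := H_mono hw.1 _ _ (by
    intro ω ω' h
    simp only [Prod.mk.injEq] at h
    exact hT _ _ h.1 h.2)
  unfold IT.condH at h1
  unfold fanoB
  linarith

lemma pr_mono {w : Ω → ℝ} (hw : ∀ ω, 0 ≤ w ω) {E F : Ω → Prop} (h : ∀ ω, E ω → F ω) :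
    IT.pr w E ≤ IT.pr w F := by
  unfold IT.pr
  refine Finset.sum_le_sum fun ω _ => ?_
  by_cases h1 : E ω
  · rw [if_pos h1, if_pos (h _ h1)]
  · rw [if_neg h1]; split_ifs <;> simp [hw]

lemma pr_or {w : Ω → ℝ} (hw : ∀ ω, 0 ≤ w ω) {E F G : Ω → Prop} (h : ∀ ω, E ω → F ω ∨ G ω) :
    IT.pr w E ≤ IT.pr w F + IT.pr w G := by
  unfold IT.pr
  rw [← Finset.sum_add_distrib]
  refine Finset.sum_le_sum fun ω _ => ?_
  have := hw ω
  by_cases h1 : E ω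
  · rw [if_pos h1]
    rcases h ω h1 with h2 | h2
    · rw [if_pos h2]; split_ifs <;> simp [hw]
    · rw [if_pos h2]; split_ifs <;> simp [hw]
  · rw [if_neg h1]; split_ifs <;> simp [hw]

end conv

section conv2
variable {X1 X2 X3 : Type} [Fintype X1] [Fintype X2] [Fintype X3]

/-- The three multi-letter rate bounds. -/
lemma converse_rates {p : X1 × X2 × X3 → ℝ} (hp : IsPMF p) {n : ℕ} {M1 M2 : Type} [Fintype M1] [Fintype M2]
    (J1 : (Fin n → X1 × X2 × X3) → M1) (J2 : (Fin n → X1 × X2 × X3) → M2)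
    (F1 : (Fin n → X1) → M2 → M1) (hF1 : ∀ ω, J1 ω = F1 (fun t => (ω t).1) (J2 ω))
    (g21 : (Fin n → X2) → M1 → Fin n → X1) (g32 : (Fin n → X3) → M1 → M2 → Fin n → X2)
    (ε : ℝ) (he : 0 < ε) (he1 : 2 * ε < 1)
    (h21 : IT.pr (iidW p n) (fun ω => g21 (fun t => (ω t).2.1) (J1 ω) ≠ fun t => (ω t).1) ≤ ε)
    (h32 : IT.pr (iidW p n) (fun ω => g32 (fun t => (ω t).2.2) (J1 ω) (J2 ω) ≠ fun t => (ω t).2.1) ≤ ε) :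
    n * IT.condH p (fun v => v.1) (fun v => v.2.1) ≤ Real.logb 2 (Fintype.card M1) +
        fanoB (2 * ε) (n * Real.logb 2 (Fintype.card (X1 × X2))) ∧
    n * IT.condH p (fun v => (v.1, v.2.1)) (fun v => v.2.2) ≤
        Real.logb 2 (Fintype.card M1) + Real.logb 2 (Fintype.card M2) +
        fanoB (2 * ε) (n * Real.logb 2 (Fintype.card (X1 × X2))) ∧
    n * (IT.H p (fun v => v) - IT.H p (fun v => v.1)) ≤ Real.logb 2 (Fintype.card M2) +
        ∑ t, IT.condH (iidW p n) (fun ω => (ω t).2.2) (fun ω => (J2 ω, fun t => (ω t).1)) +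
        fanoB (2 * ε) (n * Real.logb 2 (Fintype.card (X1 × X2))) := by
  have hw := iid_pmf hp n
  have hcard : Real.logb 2 (Fintype.card (Fin n → X1 × X2)) = n * Real.logb 2 (Fintype.card (X1 × X2)) := by
    simp only [Fintype.card_pi, Finset.prod_const, Finset.card_univ, Fintype.card_fin]
    push_cast
    rw [Real.logb_pow]
  have hI := fun {β : Type} [Fintype β] (f : X1 × X2 × X3 → β) => H_iid hp n f
  set Z : (Fin n → X1 × X2 × X3) → (Fin n → X1 × X2) := fun ω t => ((ω t).1, (ω t).2.1) with hZ
  have hcard' := hcard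
  rw [← hcard]
  refine ⟨?_, ?_, ?_⟩
  · have h1 := H_le_of_decode hw (fun ω t => ((ω t).1, (ω t).2.1)) Z
      (fun ω => (J1 ω, fun t => (ω t).2.1)) (fun y t => (g21 y.2 y.1 t, y.2 t))
      (fun ω ω' h _ => h) (2 * ε) (by linarith) he1 (by
        refine (pr_mono hw.1 ?_).trans (h21.trans (by linarith))
        intro ω hne h
        apply hne
        funext t
        simp [hZ, h])
    have h2 := H_pair_le hw J1 (fun ω t => (ω t).2.1)
    have h3 := H_le_log_card hw J1
    have e1 := hI (fun v => (v.1, v.2.1))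
    have e2 := hI (fun v => v.2.1)
    unfold IT.condH
    rw [mul_sub, ← e1, ← e2]
    linarith
  · have h1 := H_le_of_decode hw (fun ω t => (((ω t).1, (ω t).2.1), (ω t).2.2)) Z
      (fun ω => ((J1 ω, J2 ω), fun t => (ω t).2.2))
      (fun y t => (g21 (g32 y.2 y.1.1 y.1.2) y.1.1 t, g32 y.2 y.1.1 y.1.2 t))
      (fun ω ω' h h' => by
        funext t
        have := congrFun h t
        have h'' := congrFun (congrArg Prod.snd h') t
        simp only [hZ] at this h'' ⊢
        rw [this, h'']) (2 * ε) (by linarith) he1 (by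
        refine (pr_or hw.1 ?_).trans ((add_le_add h21 h32).trans (by linarith))
        intro ω hne
        by_contra hcon
        push Not at hcon
        obtain ⟨ha, hb⟩ := hcon
        apply hne
        funext t
        simp [hZ, hb, ha])
    have h2 := H_pair_le hw (fun ω => (J1 ω, J2 ω)) (fun ω t => (ω t).2.2)
    have h2' := H_pair_le hw J1 J2
    have h3 := H_le_log_card hw J1
    have h4 := H_le_log_card hw J2
    have e1 := hI (fun v => ((v.1, v.2.1), v.2.2))
    have e2 := hI (fun v => v.2.2)
    unfold IT.condH
    rw [mul_sub, ← e1, ← e2]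
    linarith
  · have h1 := H_le_of_decode hw (fun ω t => ω t) Z
      (fun ω => (fun t => (ω t).2.2, (J2 ω, fun t => (ω t).1)))
      (fun y t => (y.2.2 t, g32 y.1 (F1 y.2.2 y.2.1) y.2.1 t))
      (fun ω ω' h h' => by
        funext t
        have := congrFun h t
        have h'' := congrFun (congrArg Prod.fst h') t
        simp only [hZ, Prod.mk.injEq] at this h'' ⊢
        exact Prod.ext this.1 (Prod.ext this.2 h'')) (2 * ε) (by linarith) he1 (by
        refine (pr_mono hw.1 ?_).trans (h32.trans (by linarith))
        intro ω hne h
        apply hne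
        funext t
        rw [hF1] at h
        simp [hZ, h])
    have h2 := condH_pi_le hw (fun t ω => (ω t).2.2) (fun ω => (J2 ω, fun t => (ω t).1))
    have h2' := H_pair_le hw J2 (fun ω t => (ω t).1)
    have h4 := H_le_log_card hw J2
    have e1 := hI (fun v => v)
    have e2 := hI (fun v => v.1)
    rw [mul_sub, ← e1, ← e2]
    unfold IT.condH at h2 ⊢
    linarith

end conv2

section mix
variable {Ω : Type*} [Fintype Ω] {ν ζ β : Type*} [Fintype ν] [Fintype ζ] [Fintype β]

lemma mix_H (w : Ω → ℝ) (V : Ω → ν) (Z : Ω → ζ) (ρ : ν → ζ → ℝ)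
    (hρ1 : ∀ v, ∑ z, ρ v z = 1)
    (h : ∀ z v, IT.dist w (fun ω => (Z ω, V ω)) (z, v) = IT.dist w V v * ρ v z) (f : ζ → β) :
    IT.H w (fun ω => (f (Z ω), V ω)) = IT.H w V + ∑ v, IT.dist w V v * IT.H (ρ v) f := by
  classical
  have hd : ∀ b v, IT.dist w (fun ω => (f (Z ω), V ω)) (b, v) = IT.dist w V v * IT.dist (ρ v) f b := by
    intro b v
    have := dist_comp w (fun ω => (Z ω, V ω)) _ (fun _ => rfl) (fun zv => (f zv.1, zv.2)) (b, v)
    rw [this]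
    have hh := fun z => h z v
    generalize IT.dist w (fun ω => (Z ω, V ω)) = D at hh
    generalize IT.dist w V v = P at hh
    unfold IT.dist
    rw [Fintype.sum_prod_type_right, Finset.sum_eq_single v]
    · rw [Finset.mul_sum]
      refine Finset.sum_congr rfl fun z _ => ?_
      by_cases hz : f z = b
      · simp [hz, hh]
      · simp [hz]
    · intro v' _ hv'
      simp [hv']
    · simp
  unfold IT.H
  rw [Fintype.sum_prod_type_right, ← sub_eq_iff_eq_add', sub_neg_eq_add, ← Finset.sum_neg_distrib, ← Finset.sum_add_distrib]
  refine Finset.sum_congr rfl fun v _ => ?_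
  simp only [hd]
  have hs : ∑ b, IT.dist (ρ v) f b = 1 := by rw [sum_dist, hρ1]
  have : ∀ b, IT.dist w V v * IT.dist (ρ v) f b * Real.logb 2 (IT.dist w V v * IT.dist (ρ v) f b) =
     IT.dist w V v * Real.logb 2 (IT.dist w V v) * IT.dist (ρ v) f b +
     IT.dist w V v * (IT.dist (ρ v) f b * Real.logb 2 (IT.dist (ρ v) f b)) := by
    intro b
    by_cases h1 : IT.dist w V v = 0
    · simp [h1]
    by_cases h2 : IT.dist (ρ v) f b = 0
    · simp [h2]
    rw [Real.logb_mul h1 h2]; ring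
  simp only [this]
  rw [Finset.sum_add_distrib, ← Finset.mul_sum, hs, ← Finset.mul_sum]
  ring

end mix

section markov
variable {α β : Type*} [Fintype α] [Fintype β]

open Classical in
lemma iid_markov {p : α → ℝ} (n : ℕ) (f : α → β) (k : α → ℝ) (k' : β → ℝ)
    (hk : ∀ y, ∑ a, (if f a = y then p a * k a else 0) = ∑ a, (if f a = y then p a * k' y else 0))
    (t : Fin n) (ψ : (Fin n → β) → ℝ) :
    ∑ ω, iidW p n ω * ψ (fun s => f (ω s)) * k (ω t) =
      ∑ ω, iidW p n ω * ψ (fun s => f (ω s)) * k' (f (ω t)) := by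
  have expand : ∀ κ : α → ℝ, ∑ ω, iidW p n ω * ψ (fun s => f (ω s)) * κ (ω t) =
      ∑ y : Fin n → β, ψ y * ∏ s, ∑ a, (if f a = y s then p a * (if s = t then κ a else 1) else 0) := by
    intro κ
    have h1 : ∀ ω : Fin n → α, iidW p n ω * ψ (fun s => f (ω s)) * κ (ω t) =
        ∑ y : Fin n → β, if (fun s => f (ω s)) = y then ψ y * (iidW p n ω * κ (ω t)) else 0 := by
      intro ω
      simp; ring
    simp only [h1]
    rw [Finset.sum_comm]
    refine Finset.sum_congr rfl fun y _ => ?_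
    rw [← sum_prod_pi (fun s a => if f a = y s then p a * (if s = t then κ a else 1) else 0), Finset.mul_sum]
    refine Finset.sum_congr rfl fun ω _ => ?_
    split_ifs with h
    · congr 1
      have : ∀ s, (if f (ω s) = y s then p (ω s) * (if s = t then κ (ω s) else 1) else 0) =
        p (ω s) * (if s = t then κ (ω s) else 1) := fun s => if_pos (congrFun h s)
      simp only [this, Finset.prod_mul_distrib]
      simp [iidW]
    · obtain ⟨s, hs⟩ := Function.ne_iff.mp h
      rw [Finset.prod_eq_zero (Finset.mem_univ s), mul_zero]
      exact if_neg hs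
  rw [expand k, expand (fun a => k' (f a))]
  refine Finset.sum_congr rfl fun y _ => ?_
  congr 1
  refine Finset.prod_congr rfl fun s _ => ?_
  by_cases hs : s = t
  · simp only [hs, if_true]
    rw [hk (y t)]
    refine Finset.sum_congr rfl fun a _ => ?_
    split_ifs with h
    · rw [h]
    · rfl
  · simp [hs]

end markov
end TE

namespace TE

/-! ### Carathéodory and compactness of convex hulls -/
section hull
variable {E : Type*} [NormedAddCommGroup E] [NormedSpace ℝ E] [FiniteDimensional ℝ E]

lemma hull_fin {s : Set E} (ℓ : E →ₗ[ℝ] ℝ) (hℓ : ∀ x ∈ s, ℓ x = 1) {x : E} (hx : x ∈ convexHull ℝ s) :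
    ∃ w ∈ stdSimplex ℝ (Fin (Module.finrank ℝ E)), ∃ z : Fin (Module.finrank ℝ E) → E,
      (∀ i, z i ∈ s) ∧ ∑ i, w i • z i = x := by
  classical
  obtain ⟨ι, _, z, w, hz, hind, hw0, hw1, hsum⟩ := eq_pos_convex_span_of_mem_convexHull hx
  have hlin : LinearIndependent ℝ z := by
    rw [Fintype.linearIndependent_iff]
    intro g hg
    have h0 : ∑ i, g i = 0 := by
      have := congrArg ℓ hg
      rw [map_sum] at this
      simp only [map_smul, hℓ _ (hz (Set.mem_range_self _)), smul_eq_mul, mul_one, map_zero] at this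
      exact this
    have := (affineIndependent_iff (k := ℝ) (p := z)).1 hind Finset.univ g h0 hg
    intro i
    exact this i (Finset.mem_univ i)
  have hcard := hlin.fintype_card_le_finrank
  have hne : Nonempty ι := by
    by_contra h
    rw [not_nonempty_iff] at h
    simp at hw1
  obtain ⟨i0⟩ := hne
  obtain ⟨f⟩ : Nonempty (ι ↪ Fin (Module.finrank ℝ E)) :=
    Function.Embedding.nonempty_of_card_le (by simpa using hcard)
  have hext : ∀ i, Function.extend f w 0 (f i) = w i := fun i => f.injective.extend_apply _ _ _
  have hext' : ∀ j, j ∉ Set.range f → Function.extend f w 0 j = 0 := fun j hj => by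
    rw [Function.extend_apply' _ _ _ (by simpa using hj)]; rfl
  have hzx : ∀ i, Function.extend f z (fun _ => z i0) (f i) = z i := fun i => f.injective.extend_apply _ _ _
  refine ⟨Function.extend f w 0, ⟨fun j => ?_, ?_⟩, Function.extend f z (fun _ => z i0), fun j => ?_, ?_⟩
  · by_cases hj : j ∈ Set.range f
    · obtain ⟨i, rfl⟩ := hj
      rw [hext]; exact (hw0 i).le
    · rw [hext' j hj]
  · rw [← hw1]
    symm
    refine Finset.sum_of_injOn f (f.injective.injOn) (by simp) (fun j _ hj => hext' j (by simpa using hj)) (fun i _ => (hext i).symm)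
  · by_cases hj : j ∈ Set.range f
    · obtain ⟨i, rfl⟩ := hj
      rw [hzx]; exact hz (Set.mem_range_self _)
    · rw [Function.extend_apply' _ _ _ (by simpa using hj)]; exact hz (Set.mem_range_self _)
  · rw [← hsum]
    symm
    refine Finset.sum_of_injOn f (f.injective.injOn) (by simp) (fun j _ hj => ?_) (fun i _ => ?_)
    · rw [hext' j (by simpa using hj), zero_smul]
    · rw [hext, hzx]

lemma hull_compact {s : Set E} (hs : IsCompact s) (ℓ : E →ₗ[ℝ] ℝ) (hℓ : ∀ x ∈ s, ℓ x = 1) :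
    IsCompact (convexHull ℝ s) := by
  have hC : IsCompact ((stdSimplex ℝ (Fin (Module.finrank ℝ E))) ×ˢ (Set.univ.pi fun _ : Fin (Module.finrank ℝ E) => s)) :=
    (isCompact_stdSimplex ℝ _).prod (isCompact_univ_pi fun _ => hs)
  have := hC.image (f := fun y : (Fin (Module.finrank ℝ E) → ℝ) × (Fin (Module.finrank ℝ E) → E) => ∑ i, y.1 i • y.2 i)
    (by fun_prop)
  convert this using 1
  ext x
  constructor
  · intro hx
    obtain ⟨w, hw, z, hz, h⟩ := hull_fin ℓ hℓ hx
    exact ⟨(w, z), ⟨hw, fun i _ => hz i⟩, h⟩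
  · rintro ⟨⟨w, z⟩, ⟨hw, hz⟩, rfl⟩
    exact (convex_convexHull ℝ s).sum_mem (fun i _ => hw.1 i) hw.2
      (fun i _ => subset_convexHull ℝ s (hz i (Set.mem_univ i)))

end hull

section single
variable {X1 X2 X3 Xh1 Xh2 : Type} [Fintype X1] [Fintype X2] [Fintype X3] [Fintype Xh1] [Fintype Xh2]

def m12 (p : X1 × X2 × X3 → ℝ) (z : X1 × X2) : ℝ := ∑ c, p (z.1, z.2, c)

open Classical in
def Wk (p : X1 × X2 × X3 → ℝ) (z : X1 × X2) (c : X3) : ℝ :=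
  if m12 p z = 0 then 1 / (Fintype.card X3 : ℝ) else p (z.1, z.2, c) / m12 p z

def jt (p : X1 × X2 × X3 → ℝ) (π : X1 × X2 → ℝ) : X1 × X2 × X3 → ℝ :=
  fun v => π (v.1, v.2.1) * Wk p (v.1, v.2.1) v.2.2

lemma m12_nonneg {p : X1 × X2 × X3 → ℝ} (hp : IsPMF p) (z) : 0 ≤ m12 p z :=
  Finset.sum_nonneg fun _ _ => hp.1 _

lemma Wk_nonneg {p : X1 × X2 × X3 → ℝ} (hp : IsPMF p) (z c) : 0 ≤ Wk p z c := by
  unfold Wk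
  split_ifs
  · positivity
  · exact div_nonneg (hp.1 _) (m12_nonneg hp z)

lemma Wk_sum [Nonempty X3] (p : X1 × X2 × X3 → ℝ) (z) : ∑ c, Wk p z c = 1 := by
  unfold Wk
  by_cases h : m12 p z = 0
  · simp [h]
  · simp only [h, if_false, ← Finset.sum_div]
    exact div_self h

lemma m12_mul_Wk {p : X1 × X2 × X3 → ℝ} (hp : IsPMF p) (z c) : m12 p z * Wk p z c = p (z.1, z.2, c) := by
  unfold Wk
  by_cases h : m12 p z = 0
  · rw [h, zero_mul]
    exact ((Finset.sum_eq_zero_iff_of_nonneg fun _ _ => hp.1 _).1 h c (Finset.mem_univ c)).symm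
  · simp only [h, if_false]
    rw [mul_div_cancel₀ _ h]

lemma sum3 (f : X1 × X2 × X3 → ℝ) : ∑ v, f v = ∑ z : X1 × X2, ∑ c, f (z.1, z.2, c) := by
  simp only [Fintype.sum_prod_type]

lemma jt_pmf [Nonempty X3] {p : X1 × X2 × X3 → ℝ} (hp : IsPMF p) {π : X1 × X2 → ℝ} (hπ : π ∈ stdSimplex ℝ (X1 × X2)) :
    IsPMF (jt p π) := by
  refine ⟨fun v => mul_nonneg (hπ.1 _) (Wk_nonneg hp _ _), ?_⟩
  rw [sum3]
  simp only [jt, ← Finset.mul_sum, Wk_sum, mul_one]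
  exact hπ.2

lemma m12_simplex {p : X1 × X2 × X3 → ℝ} (hp : IsPMF p) : m12 p ∈ stdSimplex ℝ (X1 × X2) := by
  refine ⟨m12_nonneg hp, ?_⟩
  rw [← hp.2, sum3]; rfl

lemma dist_12 (p : X1 × X2 × X3 → ℝ) (z) : IT.dist p (fun v => (v.1, v.2.1)) z = m12 p z := by
  classical
  unfold IT.dist m12
  rw [sum3, Finset.sum_eq_single z]
  · simp
  · intro z' _ h
    refine Finset.sum_eq_zero fun c _ => if_neg h
  · simp

abbrev EE (X1 X2 : Type) := (X1 × X2 → ℝ) × ℝ × ℝ × ℝ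

def pt (p : X1 × X2 × X3 → ℝ) (d1 : X1 → Xh1 → ℝ) (d2 : X2 → Xh2 → ℝ)
    (π : X1 × X2 → ℝ) (g31 : X2 → X3 → Xh1) (g12 : X1 → Xh2) : EE X1 X2 :=
  (π, IT.condH (jt p π) (fun v => v.2.2) (fun v => v.1),
    IT.expect (jt p π) (fun v => d1 v.1 (g31 v.2.1 v.2.2)),
    IT.expect (jt p π) (fun v => d2 v.2.1 (g12 v.1)))

def SS (p : X1 × X2 × X3 → ℝ) (d1 : X1 → Xh1 → ℝ) (d2 : X2 → Xh2 → ℝ) : Set (EE X1 X2) :=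
  {e | ∃ π ∈ stdSimplex ℝ (X1 × X2), ∃ g31 g12, e = pt p d1 d2 π g31 g12}

lemma H_cont (p : X1 × X2 × X3 → ℝ) {β : Type*} [Fintype β] (f : X1 × X2 × X3 → β) :
    Continuous (fun π => IT.H (jt p π) f) := by
  unfold IT.H
  refine Continuous.neg (continuous_finsetSum _ fun a _ => ?_)
  have h1 : Continuous (fun π => IT.dist (jt p π) f a) := by
    unfold IT.dist jt
    refine continuous_finsetSum _ fun v _ => ?_
    split_ifs
    · fun_prop
    · fun_prop
  have h2 : Continuous (fun x : ℝ => x * Real.logb 2 x) := by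
    unfold Real.logb
    simp only [← mul_div_assoc]
    exact Real.continuous_mul_log.div_const _
  exact h2.comp h1

lemma SS_compact (p : X1 × X2 × X3 → ℝ) (d1 : X1 → Xh1 → ℝ) (d2 : X2 → Xh2 → ℝ) : IsCompact (SS p d1 d2) := by
  have : SS p d1 d2 = ⋃ g : (X2 → X3 → Xh1) × (X1 → Xh2), Set.image (fun π => pt p d1 d2 π g.1 g.2) (stdSimplex ℝ (X1 × X2)) := by
    ext e
    simp only [SS, Set.mem_ofPred_eq, Set.mem_iUnion, Set.mem_image, Prod.exists]
    constructor
    · rintro ⟨π, h, g, g', rfl⟩; exact ⟨g, g', π, h, rfl⟩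
    · rintro ⟨g, g', π, h, rfl⟩; exact ⟨π, h, g, g', rfl⟩
  rw [this]
  refine isCompact_iUnion fun g => (isCompact_stdSimplex ℝ _).image ?_
  unfold pt IT.condH
  refine Continuous.prodMk continuous_id (Continuous.prodMk ((H_cont p _).sub (H_cont p _)) (Continuous.prodMk ?_ ?_))
  · unfold IT.expect jt; fun_prop
  · unfold IT.expect jt; fun_prop

def ellE (X1 X2 : Type) [Fintype X1] [Fintype X2] : EE X1 X2 →ₗ[ℝ] ℝ where
  toFun e := ∑ z, e.1 z
  map_add' a b := by simp [Finset.sum_add_distrib]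
  map_smul' a b := by simp [Finset.mul_sum]

lemma ellE_SS (p : X1 × X2 × X3 → ℝ) (d1 : X1 → Xh1 → ℝ) (d2 : X2 → Xh2 → ℝ) :
    ∀ e ∈ SS p d1 d2, ellE X1 X2 e = 1 := by
  rintro _ ⟨π, h, g, g', rfl⟩
  exact h.2

lemma finrank_EE : Module.finrank ℝ (EE X1 X2) = Fintype.card X1 * Fintype.card X2 + 3 := by
  simp [EE]

end single
end TE

namespace TE

section point
variable {X1 X2 X3 Xh1 Xh2 : Type} [Fintype X1] [Fintype X2] [Fintype X3] [Fintype Xh1] [Fintype Xh2]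

lemma markov_dist {p : X1 × X2 × X3 → ℝ} (hp : IsPMF p) {n : ℕ} {ν : Type} [Fintype ν]
    (Vf : (Fin n → X1 × X2) → ν) (t : Fin n) (y : X1 × X2 × X3) (v : ν) :
    IT.dist (iidW p n) (fun ω => (ω t, Vf (fun s => ((ω s).1, (ω s).2.1)))) (y, v) =
    IT.dist (iidW p n) (fun ω => (((ω t).1, (ω t).2.1), Vf (fun s => ((ω s).1, (ω s).2.1)))) ((y.1, y.2.1), v) *
      Wk p (y.1, y.2.1) y.2.2 := by
  classical
  have hk : ∀ z : X1 × X2, ∑ a : X1 × X2 × X3, (if (a.1, a.2.1) = z then p a * (if a.2.2 = y.2.2 then 1 else 0) else 0)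
      = ∑ a : X1 × X2 × X3, (if (a.1, a.2.1) = z then p a * Wk p z y.2.2 else 0) := by
    intro z
    have h2 : ∀ a : X1 × X2 × X3, (if (a.1, a.2.1) = z then p a * Wk p z y.2.2 else 0) =
      (if (a.1, a.2.1) = z then p a else 0) * Wk p z y.2.2 := by intro a; split_ifs <;> simp
    simp only [h2]
    rw [← Finset.sum_mul]
    have h3 := dist_12 p z
    unfold IT.dist at h3
    have h3' : ∑ a : X1 × X2 × X3, (if (a.1, a.2.1) = z then p a else 0) = m12 p z := by
      rw [← h3]; exact Finset.sum_congr rfl fun a _ => by congr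
    rw [h3', m12_mul_Wk hp, sum3, Finset.sum_eq_single z, Finset.sum_eq_single y.2.2]
    · simp
    · intro c _ hc; simp [hc]
    · simp
    · intro z' _ hz'
      exact Finset.sum_eq_zero fun c _ => if_neg hz'
    · simp
  have := iid_markov (p := p) n (fun v => (v.1, v.2.1)) (fun v => if v.2.2 = y.2.2 then 1 else 0)
    (fun z => Wk p z y.2.2) (fun z => by convert hk z) t (fun x => if x t = (y.1, y.2.1) ∧ Vf x = v then 1 else 0)
  unfold IT.dist
  rw [Finset.sum_mul]
  convert this using 2 with ω _ ω _
  · obtain ⟨a, b, c⟩ := y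
    have : (ω t, Vf (fun s => ((ω s).1, (ω s).2.1))) = ((a, b, c), v) ↔
      (((ω t).1, (ω t).2.1) = (a, b) ∧ Vf (fun s => ((ω s).1, (ω s).2.1)) = v) ∧ (ω t).2.2 = c := by
      rw [Prod.mk.injEq, Prod.mk.injEq, Prod.ext_iff, Prod.ext_iff]
      tauto
    simp only [this]
    by_cases h1 : (((ω t).1, (ω t).2.1) = (a, b) ∧ Vf (fun s => ((ω s).1, (ω s).2.1)) = v) <;>
      by_cases h2 : (ω t).2.2 = c <;> simp only [h1, h2, and_true, and_false, if_true, if_false, mul_one, mul_zero, and_self] 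
  · obtain ⟨a, b, c⟩ := y
    rw [Prod.mk.injEq]
    by_cases h1 : (((ω t).1, (ω t).2.1) = (a, b) ∧ Vf (fun s => ((ω s).1, (ω s).2.1)) = v)
    · simp only [h1, and_self, if_true, mul_one]
    · simp only [h1, if_false, mul_zero, zero_mul]

lemma conv_point [Nonempty X3] [Nonempty Xh1] {p : X1 × X2 × X3 → ℝ} (hp : IsPMF p)
    (d1 : X1 → Xh1 → ℝ) (d2 : X2 → Xh2 → ℝ) {n : ℕ} (hn : 0 < n) {M2 : Type} [Fintype M2]
    (G : (Fin n → X1 × X2) → M2) (r12 : (Fin n → X1) → M2 → Fin n → Xh2)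
    (ρ1 : (Fin n → X1 × X2 × X3) → Fin n → Xh1) :
    ∃ D1 D2 : ℝ, (m12 p, (1 / (n : ℝ)) * ∑ t, IT.condH (iidW p n) (fun ω => (ω t).2.2)
        (fun ω => (G (fun s => ((ω s).1, (ω s).2.1)), fun s => (ω s).1)), D1, D2) ∈ convexHull ℝ (SS p d1 d2) ∧
      D1 ≤ (1 / (n : ℝ)) * ∑ t : Fin n, IT.expect (iidW p n) (fun ω => d1 (ω t).1 (ρ1 ω t)) ∧
      D2 ≤ (1 / (n : ℝ)) * ∑ t : Fin n, IT.expect (iidW p n) (fun ω => d2 (ω t).2.1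
          (r12 (fun s => (ω s).1) (G (fun s => ((ω s).1, (ω s).2.1))) t)) := by
  classical
  have hw := iid_pmf hp n
  have hn' : (n : ℝ) ≠ 0 := by positivity
  set w := iidW p n with hwdef
  set Vf : (Fin n → X1 × X2) → M2 × (Fin n → X1) := fun x => (G x, fun s => (x s).1) with hVf
  set V : (Fin n → X1 × X2 × X3) → M2 × (Fin n → X1) := fun ω => Vf (fun s => ((ω s).1, (ω s).2.1)) with hV
  set P := IT.dist w V with hP
  set Q : Fin n → (X1 × X2) → M2 × (Fin n → X1) → ℝ := fun t z v =>
    IT.dist w (fun ω => (((ω t).1, (ω t).2.1), V ω)) (z, v) with hQ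
  have hQ0 : ∀ t z v, 0 ≤ Q t z v := fun t z v => dist_nonneg hw.1 _ _
  have hQP : ∀ t v, ∑ z, Q t z v = P v := by
    intro t v
    simp only [hQ, hP, IT.dist]
    rw [Finset.sum_comm]
    refine Finset.sum_congr rfl fun ω _ => ?_
    by_cases h : V ω = v <;> simp [h]
  have hQm : ∀ t z, ∑ v, Q t z v = m12 p z := by
    intro t z
    rw [← dist_12]
    have h1 := iid_expect hp n t (fun a => if (a.1, a.2.1) = z then 1 else 0)
    simp only [mul_ite, mul_one, mul_zero] at h1
    simp only [hQ, IT.dist]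
    rw [Finset.sum_comm]
    refine Eq.trans (Finset.sum_congr rfl fun ω _ => ?_) (h1.trans (Finset.sum_congr rfl fun ω _ => by congr))
    by_cases h : ((ω t).1, (ω t).2.1) = z
    · simp [h]; rfl
    · simp [h]
  set π : Fin n → M2 × (Fin n → X1) → X1 × X2 → ℝ := fun t v =>
    if P v = 0 then m12 p else fun z => Q t z v / P v with hπ
  have hPπ : ∀ t v z, P v * π t v z = Q t z v := by
    intro t v z
    by_cases h : P v = 0
    · rw [h, zero_mul]
      have := hQP t v
      rw [h] at this
      exact ((Finset.sum_eq_zero_iff_of_nonneg fun z _ => hQ0 t z v).1 this z (Finset.mem_univ z)).symm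
    · simp only [hπ, h, if_false]
      rw [mul_div_cancel₀ _ h]
  have hπs : ∀ t v, π t v ∈ stdSimplex ℝ (X1 × X2) := by
    intro t v
    by_cases h : P v = 0
    · simp only [hπ, h, if_true]; exact m12_simplex hp
    · simp only [hπ, h, if_false]
      refine ⟨fun z => div_nonneg (hQ0 _ _ _) (dist_nonneg hw.1 _ _), ?_⟩
      rw [← Finset.sum_div, hQP, div_self h]
  have hfull : ∀ t y v, IT.dist w (fun ω => (ω t, V ω)) (y, v) = P v * jt p (π t v) y := by
    intro t y v
    have := markov_dist hp Vf t y v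
    rw [show IT.dist w (fun ω => (ω t, V ω)) (y, v) = _ from this]
    unfold jt
    rw [← mul_assoc, hPπ]
  have hexp : ∀ t (φ : M2 × (Fin n → X1) → X1 × X2 × X3 → ℝ),
      ∑ v, P v * IT.expect (jt p (π t v)) (φ v) = IT.expect w (fun ω => φ (V ω) (ω t)) := by
    intro t φ
    unfold IT.expect
    have h1 := sum_dist_mul w (fun ω => (ω t, V ω)) (fun yv => φ yv.2 yv.1)
    rw [← h1]
    conv_rhs => rw [Fintype.sum_prod_type_right]
    refine Finset.sum_congr rfl fun v _ => ?_
    rw [Finset.mul_sum]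
    refine Finset.sum_congr rfl fun y _ => ?_
    rw [hfull]; ring
  have hent : ∀ t, ∑ v, P v * IT.condH (jt p (π t v)) (fun y => y.2.2) (fun y => y.1) =
      IT.condH w (fun ω => (ω t).2.2) V := by
    intro t
    have hρ : ∀ v, ∑ z, jt p (π t v) z = 1 := fun v => (jt_pmf hp (hπs t v)).2
    have h1 := mix_H w V (fun ω => ω t) (fun v => jt p (π t v)) hρ (fun z v => hfull t z v) (fun y => (y.2.2, y.1))
    have h2 := mix_H w V (fun ω => ω t) (fun v => jt p (π t v)) hρ (fun z v => hfull t z v) (fun y => y.1)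
    have hx : ∀ ω ω' : Fin n → X1 × X2 × X3, V ω = V ω' → (ω t).1 = (ω' t).1 := by
      intro ω ω' h
      exact congrFun (congrArg Prod.snd h) t
    have h3 : IT.H w (fun ω => (((ω t).2.2, (ω t).1), V ω)) = IT.H w (fun ω => ((ω t).2.2, V ω)) := by
      refine H_congr _ _ _ fun ω ω' => ?_
      simp only [Prod.mk.injEq]
      constructor
      · rintro ⟨⟨a, b⟩, c⟩; exact ⟨a, c⟩
      · rintro ⟨a, c⟩; exact ⟨⟨a, hx _ _ c⟩, c⟩
    have h4 : IT.H w (fun ω => ((ω t).1, V ω)) = IT.H w V := by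
      refine H_congr _ _ _ fun ω ω' => ?_
      simp only [Prod.mk.injEq]
      constructor
      · rintro ⟨a, c⟩; exact c
      · intro c; exact ⟨hx _ _ c, c⟩
    unfold IT.condH
    simp only [mul_sub, Finset.sum_sub_distrib]
    rw [← h3]
    linarith
  choose best hbest using fun a => Finite.exists_min (d1 a)
  set e : Fin n × (M2 × (Fin n → X1)) → EE X1 X2 := fun i =>
    pt p d1 d2 (π i.1 i.2) (fun _ _ => best (i.2.2 i.1)) (fun _ => r12 i.2.2 i.2.1 i.1) with he
  set lam : Fin n × (M2 × (Fin n → X1)) → ℝ := fun i => (1 / (n:ℝ)) * P i.2 with hlam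
  have hmem : ∑ i, lam i • e i ∈ convexHull ℝ (SS p d1 d2) := by
    refine (convex_convexHull ℝ _).sum_mem (fun i _ => ?_) ?_ (fun i _ => subset_convexHull ℝ _ ?_)
    · exact mul_nonneg (by positivity) (dist_nonneg hw.1 _ _)
    · rw [Fintype.sum_prod_type]
      simp only [hlam, ← Finset.mul_sum, hP, sum_dist, hw.2]
      simp [hn']
    · exact ⟨_, hπs _ _, _, _, rfl⟩
  have hc1 : (∑ i, lam i • e i).1 = m12 p := by
    funext z
    rw [Prod.fst_sum, Finset.sum_apply, Fintype.sum_prod_type]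
    simp only [he, hlam, pt, Prod.smul_fst, Pi.smul_apply, smul_eq_mul, mul_assoc, hPπ, ← Finset.mul_sum, hQm]
    simp [hn']
  have hc2 : (∑ i, lam i • e i).2.1 = (1 / (n : ℝ)) * ∑ t, IT.condH w (fun ω => (ω t).2.2) V := by
    rw [Prod.snd_sum, Prod.fst_sum, Fintype.sum_prod_type, Finset.mul_sum]
    simp only [he, hlam, pt, Prod.smul_snd, Prod.smul_fst, smul_eq_mul, mul_assoc, ← Finset.mul_sum, hent]
  have hc3 : (∑ i, lam i • e i).2.2.1 = (1 / (n : ℝ)) * ∑ t : Fin n, IT.expect w (fun ω => d1 (ω t).1 (best (ω t).1)) := by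
    rw [Prod.snd_sum, Prod.snd_sum, Prod.fst_sum, Fintype.sum_prod_type, Finset.mul_sum]
    simp only [he, hlam, pt, Prod.smul_snd, Prod.smul_fst, smul_eq_mul, mul_assoc, ← Finset.mul_sum]
    congr 1
    refine Finset.sum_congr rfl fun t _ => ?_
    rw [hexp t (fun v y => d1 y.1 (best (v.2 t)))]
  have hc4 : (∑ i, lam i • e i).2.2.2 = (1 / (n : ℝ)) * ∑ t : Fin n, IT.expect w (fun ω => d2 (ω t).2.1
          (r12 (fun s => (ω s).1) (G (fun s => ((ω s).1, (ω s).2.1))) t)) := by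
    rw [Prod.snd_sum, Prod.snd_sum, Prod.snd_sum, Fintype.sum_prod_type, Finset.mul_sum]
    simp only [he, hlam, pt, Prod.smul_snd, smul_eq_mul, mul_assoc, ← Finset.mul_sum]
    congr 1
    refine Finset.sum_congr rfl fun t _ => ?_
    rw [hexp t (fun v y => d2 y.2.1 (r12 v.2 v.1 t))]
  refine ⟨(∑ i, lam i • e i).2.2.1, (∑ i, lam i • e i).2.2.2, ?_, ?_, le_of_eq hc4⟩
  · rw [← hc1, ← hc2]; exact hmem
  · rw [hc3]
    refine mul_le_mul_of_nonneg_left (Finset.sum_le_sum fun t _ => ?_) (by positivity)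
    unfold IT.expect
    exact Finset.sum_le_sum fun ω _ => mul_le_mul_of_nonneg_left (hbest _ _) (hw.1 ω)

end point
end TE

namespace TE

/-- The operational side of the theorem. -/
def Oper {X1 X2 X3 Xh1 Xh2 : Type} [Fintype X1] [Fintype X2] [Fintype X3]
    (p : X1 × X2 × X3 → ℝ) (d1 : X1 → Xh1 → ℝ) (d2 : X2 → Xh2 → ℝ)
    (R1 R2 D12 D31 : ℝ) : Prop :=
    (∀ ε > (0 : ℝ), ∃ (n K : ℕ), 0 < n ∧ ∃ m1 m2 : Fin K → ℕ,
      (∀ l, 0 < m1 l) ∧ (∀ l, 0 < m2 l) ∧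
      ∃ (J1 : (l : Fin K) → (Fin n → X1 × X2 × X3) → Fin (m1 l))
        (J2 : (l : Fin K) → (Fin n → X1 × X2 × X3) → Fin (m2 l))
        (g12 : (Fin n → X1) → ((l : Fin K) → Fin (m2 l)) → Fin n → Xh2)
        (g21 : (Fin n → X2) → ((l : Fin K) → Fin (m1 l)) → Fin n → X1)
        (g31 : (Fin n → X3) → ((l : Fin K) → Fin (m1 l)) → ((l : Fin K) → Fin (m2 l)) → Fin n → Xh1)
        (g32 : (Fin n → X3) → ((l : Fin K) → Fin (m1 l)) → ((l : Fin K) → Fin (m2 l)) → Fin n → X2),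
        -- encoder causality
        (∀ l : Fin K, ∃ f : (Fin n → X1) →
            ((k : Fin K) → k.val < l.val → Fin (m2 k)) → Fin (m1 l),
          ∀ ω, J1 l ω = f (fun t => (ω t).1) (fun k _ => J2 k ω)) ∧
        (∀ l : Fin K, ∃ f : (Fin n → X2) →
            ((k : Fin K) → k.val ≤ l.val → Fin (m1 k)) → Fin (m2 l),
          ∀ ω, J2 l ω = f (fun t => (ω t).2.1) (fun k _ => J1 k ω)) ∧
        -- rates
        (1 / (n : ℝ)) * ∑ l, Real.logb 2 (m1 l) ≤ R1 + ε ∧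
        (1 / (n : ℝ)) * ∑ l, Real.logb 2 (m2 l) ≤ R2 + ε ∧
        -- node 1 reconstructs X₂ⁿ within distortion D12
        (1 / (n : ℝ)) * ∑ t : Fin n, IT.expect (iidW p n)
            (fun ω => d2 (ω t).2.1
              (g12 (fun s => (ω s).1) (fun l => J2 l ω) t)) ≤ D12 + ε ∧
        -- node 2 reconstructs X₁ⁿ losslessly
        IT.pr (iidW p n)
          (fun ω => (fun t => g21 (fun s => (ω s).2.1) (fun l => J1 l ω) t) ≠
            fun t => (ω t).1) ≤ ε ∧
        -- node 3 reconstructs X₂ⁿ losslessly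
        IT.pr (iidW p n)
          (fun ω => (fun t => g32 (fun s => (ω s).2.2) (fun l => J1 l ω) (fun l => J2 l ω) t) ≠
            fun t => (ω t).2.1) ≤ ε ∧
        -- node 3 reconstructs X₁ⁿ within distortion D31
        (1 / (n : ℝ)) * ∑ t : Fin n, IT.expect (iidW p n)
            (fun ω => d1 (ω t).1
              (g31 (fun s => (ω s).2.2) (fun l => J1 l ω) (fun l => J2 l ω) t)) ≤ D31 + ε)

/-- The single-letter side of the theorem. -/
def Single {X1 X2 X3 Xh1 Xh2 : Type} [Fintype X1] [Fintype X2] [Fintype X3]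
    (p : X1 × X2 × X3 → ℝ) (d1 : X1 → Xh1 → ℝ) (d2 : X2 → Xh2 → ℝ)
    (R1 R2 D12 D31 : ℝ) : Prop :=
    (∃ u : ℕ, u ≤ Fintype.card X1 * Fintype.card X2 + 3 ∧
      ∃ q : X1 × X2 × X3 × Fin u → ℝ, IsPMF q ∧
        (∀ a b c, (∑ d : Fin u, q (a, b, c, d)) = p (a, b, c)) ∧
        -- Markov chain U -∘- (X1,X2) -∘- X3
        IT.condMutInfo q (fun v => v.2.2.2) (fun v => v.2.2.1) (fun v => (v.1, v.2.1)) = 0 ∧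
        ∃ (g31 : X2 → X3 → Fin u → Xh1) (g12 : X1 → Fin u → Xh2),
          IT.expect q (fun v => d1 v.1 (g31 v.2.1 v.2.2.1 v.2.2.2)) ≤ D31 ∧
          IT.expect q (fun v => d2 v.2.1 (g12 v.1 v.2.2.2)) ≤ D12 ∧
          IT.condH q (fun v => v.1) (fun v => v.2.1) ≤ R1 ∧
          IT.condMutInfo q (fun v => v.2.2.2) (fun v => v.2.1) (fun v => v.1) +
            IT.condH q (fun v => v.2.1) (fun v => (v.2.2.2, v.1, v.2.2.1)) ≤ R2 ∧
          IT.condH q (fun v => (v.1, v.2.1)) (fun v => v.2.2.1) ≤ R1 + R2)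

end TE

namespace TE

lemma fanoB_div {e L : ℝ} (he : 0 < e) (he1 : e < 1) {n : ℕ} (hn : 0 < n) :
    fanoB e (n * L) ≤ n * fanoB e L := by
  have h1 : 0 ≤ -Real.logb 2 (1 - e) := by
    rw [neg_nonneg]; exact Real.logb_nonpos (by norm_num) (by linarith) (by linarith)
  have h2 : 0 ≤ -(e * Real.logb 2 e) := by
    rw [neg_nonneg]
    exact mul_nonpos_of_nonneg_of_nonpos he.le (Real.logb_nonpos (by norm_num) he.le he1.le)
  have h3 : (1:ℝ) ≤ n := by exact_mod_cast hn
  unfold fanoB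
  nlinarith

lemma fanoB_small (L : ℝ) {δ : ℝ} (hδ : 0 < δ) : ∃ ε : ℝ, 0 < ε ∧ 2 * ε < 1 ∧ 2 * ε + fanoB (2 * ε) L ≤ δ ∧
    ε + fanoB (2 * ε) L ≤ δ ∧ ε ≤ δ := by
  have hc : ContinuousAt (fun ε : ℝ => 2 * ε + fanoB (2 * ε) L) 0 := by
    unfold fanoB
    have h2 : Continuous (fun x : ℝ => x * Real.logb 2 x) := by
      unfold Real.logb
      simp only [← mul_div_assoc]
      exact Real.continuous_mul_log.div_const _
    have h3 : Continuous (fun ε : ℝ => 2 * ε * Real.logb 2 (2 * ε)) := h2.comp (continuous_const.mul continuous_id)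
    have h4 : ContinuousAt (fun ε : ℝ => Real.logb 2 (1 - 2 * ε)) 0 := by
      unfold Real.logb
      refine ContinuousAt.div_const (ContinuousAt.log (by fun_prop) (by norm_num)) _
    have h5 : ContinuousAt (fun ε : ℝ => 2 * ε + (-Real.logb 2 (1 - 2 * ε) - 2 * ε * Real.logb 2 (2 * ε) + 2 * ε * L)) 0 := by
      refine ContinuousAt.add (by fun_prop) (ContinuousAt.add (ContinuousAt.sub h4.neg h3.continuousAt) (by fun_prop))
    exact h5
  have h0 : 2 * (0:ℝ) + fanoB (2 * 0) L = 0 := by simp [fanoB]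
  have h1 := (Metric.continuousAt_iff.1 hc) δ hδ
  obtain ⟨η, hη, h⟩ := h1
  set ε := min (η / 2) (min (1/4) δ) with hε
  have e0 : 0 < ε := by positivity
  have e1 : ε ≤ η / 2 := min_le_left _ _
  have e2 : ε ≤ 1 / 4 := (min_le_right _ _).trans (min_le_left _ _)
  have e3 : ε ≤ δ := (min_le_right _ _).trans (min_le_right _ _)
  have := h (x := ε) (by rw [Real.dist_eq, sub_zero, abs_of_pos e0]; linarith)
  rw [h0, Real.dist_eq, sub_zero] at this
  have := (abs_lt.1 this).2
  exact ⟨ε, e0, by linarith, this.le, by linarith, e3⟩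

section conv
variable {X1 X2 X3 Xh1 Xh2 : Type} [Fintype X1] [Fintype X2] [Fintype X3] [Fintype Xh1] [Fintype Xh2]
    [Nonempty X1] [Nonempty X2] [Nonempty X3] [Nonempty Xh1] [Nonempty Xh2]

lemma converse_step {p : X1 × X2 × X3 → ℝ} (hp : IsPMF p) {d1 : X1 → Xh1 → ℝ} {d2 : X2 → Xh2 → ℝ}
    {R1 R2 D12 D31 : ℝ} (h : Oper p d1 d2 R1 R2 D12 D31) {δ : ℝ} (hδ : 0 < δ) :
    IT.condH p (fun v => v.1) (fun v => v.2.1) ≤ R1 + δ ∧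
    IT.condH p (fun v => (v.1, v.2.1)) (fun v => v.2.2) ≤ R1 + R2 + δ ∧
    ∃ F D1 D2 : ℝ, (m12 p, F, D1, D2) ∈ convexHull ℝ (SS p d1 d2) ∧
      IT.H p (fun v => v) - IT.H p (fun v => v.1) ≤ R2 + F + δ ∧ D1 ≤ D31 + δ ∧ D2 ≤ D12 + δ := by
  obtain ⟨ε, he, he1, hs1, hs2, hs3⟩ := fanoB_small (Real.logb 2 (Fintype.card (X1 × X2))) hδ
  obtain ⟨n, K, hn, m1, m2, hm1, hm2, J1, J2, g12, g21, g31, g32, hf1, hf2, hr1, hr2, hD12, h21, h32, hD31⟩ := h ε he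
  choose f1 hf1 using hf1
  choose f2 hf2 using hf2
  have hdep : ∀ ω ω' : Fin n → X1 × X2 × X3,
      (fun t => ((ω t).1, (ω t).2.1)) = (fun t => ((ω' t).1, (ω' t).2.1)) →
      ∀ m : ℕ, ∀ l : Fin K, l.val < m → J1 l ω = J1 l ω' ∧ J2 l ω = J2 l ω' := by
    intro ω ω' heq m
    have ha : (fun t => (ω t).1) = (fun t => (ω' t).1) := by
      funext t; exact (Prod.mk.inj (congrFun heq t)).1
    have hb : (fun t => (ω t).2.1) = (fun t => (ω' t).2.1) := by
      funext t; exact (Prod.mk.inj (congrFun heq t)).2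
    induction m with
    | zero => intro l hl; omega
    | succ m ih =>
      intro l hl
      have h1 : J1 l ω = J1 l ω' := by
        rw [hf1, hf1, ha]
        congr 1
        funext k hk
        exact (ih k (by omega)).2
      refine ⟨h1, ?_⟩
      rw [hf2, hf2, hb]
      congr 1
      funext k hk
      rcases hk.lt_or_eq with hk' | hk'
      · exact (ih k (by omega)).1
      · have : k = l := Fin.ext hk'
        subst this; exact h1
  set c0 : X3 := Classical.arbitrary X3
  set G : (Fin n → X1 × X2) → ((l : Fin K) → Fin (m2 l)) := fun x l => J2 l (fun t => ((x t).1, (x t).2, c0)) with hG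
  have hJ2G : ∀ ω, (fun l => J2 l ω) = G (fun t => ((ω t).1, (ω t).2.1)) := by
    intro ω
    funext l
    exact (hdep ω (fun t => ((ω t).1, (ω t).2.1, c0)) rfl K l l.2).2
  have hrates := converse_rates hp (M1 := (l : Fin K) → Fin (m1 l)) (M2 := (l : Fin K) → Fin (m2 l))
    (fun ω l => J1 l ω) (fun ω l => J2 l ω) (fun x j l => f1 l x (fun k _ => j k))
    (fun ω => by funext l; exact hf1 l ω) g21 g32 ε he he1 h21 h32
  have hcard : ∀ m : Fin K → ℕ, (∀ l, 0 < m l) →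
      Real.logb 2 (Fintype.card ((l : Fin K) → Fin (m l))) = ∑ l, Real.logb 2 (m l) := by
    intro m hm
    rw [Fintype.card_pi]
    simp only [Fintype.card_fin]
    push_cast
    rw [Real.logb_prod]
    intro l _
    exact_mod_cast (hm l).ne'
  rw [hcard m1 hm1, hcard m2 hm2] at hrates
  have hn' : (0:ℝ) < n := by exact_mod_cast hn
  have hr1' : ∑ l, Real.logb 2 (m1 l) ≤ n * (R1 + ε) := by
    rw [one_div, inv_mul_le_iff₀ hn'] at hr1; exact hr1
  have hr2' : ∑ l, Real.logb 2 (m2 l) ≤ n * (R2 + ε) := by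
    rw [one_div, inv_mul_le_iff₀ hn'] at hr2; exact hr2
  have hfan := fanoB_div (L := Real.logb 2 (Fintype.card (X1 × X2))) (by linarith : 0 < 2 * ε) he1 hn
  set Φ := fanoB (2 * ε) (Real.logb 2 (Fintype.card (X1 × X2))) with hΦ
  obtain ⟨ha, hb, hc⟩ := hrates
  obtain ⟨D1, D2, hmem, hD1, hD2⟩ := conv_point hp d1 d2 hn G g12
    (fun ω => g31 (fun s => (ω s).2.2) (fun l => J1 l ω) (fun l => J2 l ω))
  refine ⟨?_, ?_, _, D1, D2, hmem, ?_, ?_, ?_⟩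
  · refine le_of_mul_le_mul_left ?_ hn'
    nlinarith
  · refine le_of_mul_le_mul_left ?_ hn'
    nlinarith
  · refine le_of_mul_le_mul_left ?_ hn'
    simp only [hJ2G] at hc
    set S := ∑ t, IT.condH (iidW p n) (fun ω => (ω t).2.2)
        (fun ω => (G (fun s => ((ω s).1, (ω s).2.1)), fun s => (ω s).1))
    have : (n:ℝ) * (R2 + 1 / (n:ℝ) * S + δ) = n * R2 + S + n * δ := by field_simp
    rw [this]
    nlinarith
  · linarith
  · simp only [hJ2G] at hD12
    linarith

def e4 (X1 X2 X3 : Type) (u : ℕ) : X1 × X2 × X3 × Fin u ≃ (X1 × X2 × X3) × Fin u where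
  toFun v := ((v.1, v.2.1, v.2.2.1), v.2.2.2)
  invFun v := (v.1.1, v.1.2.1, v.1.2.2, v.2)
  left_inv _ := rfl
  right_inv _ := rfl

lemma sum4 {u : ℕ} (f : X1 × X2 × X3 × Fin u → ℝ) :
    ∑ v, f v = ∑ i, ∑ y : X1 × X2 × X3, f (y.1, y.2.1, y.2.2, i) := by
  rw [Fintype.sum_equiv (e4 X1 X2 X3 u) f (fun v => f ((e4 X1 X2 X3 u).symm v)) (fun v => by simp),
    Fintype.sum_prod_type_right]
  rfl

/-- The chain rule identity turning the rate of node 2 into a difference of entropies. -/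
lemma rate2_identity {u : ℕ} (q : X1 × X2 × X3 × Fin u → ℝ) :
    IT.condMutInfo q (fun v => v.2.2.2) (fun v => v.2.1) (fun v => v.1) +
            IT.condH q (fun v => v.2.1) (fun v => (v.2.2.2, v.1, v.2.2.1)) =
    IT.H q (fun v => (v.1, v.2.1, v.2.2.1)) - IT.H q (fun v => v.1)
      - (IT.H q (fun v => ((v.2.2.1, v.1), v.2.2.2)) - IT.H q (fun v => (v.1, v.2.2.2)))
      - IT.condMutInfo q (fun v => v.2.2.2) (fun v => v.2.2.1) (fun v => (v.1, v.2.1)) := by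
  unfold IT.condMutInfo IT.condH
  have c1 : IT.H q (fun v => (v.2.2.2, v.1)) = IT.H q (fun v => (v.1, v.2.2.2)) :=
    H_congr _ _ _ (fun _ _ => by simp only [Prod.mk.injEq]; tauto)
  have c2 : IT.H q (fun v => (v.2.2.2, v.2.1, v.1)) = IT.H q (fun v => (v.2.2.2, v.1, v.2.1)) :=
    H_congr _ _ _ (fun _ _ => by simp only [Prod.mk.injEq]; tauto)
  have c3 : IT.H q (fun v => (v.2.1, v.1)) = IT.H q (fun v => (v.1, v.2.1)) :=
    H_congr _ _ _ (fun _ _ => by simp only [Prod.mk.injEq]; tauto)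
  have c4 : IT.H q (fun v => (v.2.1, v.2.2.2, v.1, v.2.2.1)) = IT.H q (fun v => (v.2.2.2, v.2.2.1, v.1, v.2.1)) :=
    H_congr _ _ _ (fun _ _ => by simp only [Prod.mk.injEq]; tauto)
  have c5 : IT.H q (fun v => (v.2.2.2, v.1, v.2.2.1)) = IT.H q (fun v => ((v.2.2.1, v.1), v.2.2.2)) :=
    H_congr _ _ _ (fun _ _ => by simp only [Prod.mk.injEq]; tauto)
  have c6 : IT.H q (fun v => (v.1, v.2.1, v.2.2.1)) = IT.H q (fun v => (v.2.2.1, v.1, v.2.1)) :=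
    H_congr _ _ _ (fun _ _ => by simp only [Prod.mk.injEq]; tauto)
  rw [c1, c2, c3, c4, c5, c6]
  ring

theorem converse {p : X1 × X2 × X3 → ℝ} (hp : IsPMF p) {d1 : X1 → Xh1 → ℝ} {d2 : X2 → Xh2 → ℝ}
    {R1 R2 D12 D31 : ℝ} (h : Oper p d1 d2 R1 R2 D12 D31) : Single p d1 d2 R1 R2 D12 D31 := by
  classical
  have hR1 : IT.condH p (fun v => v.1) (fun v => v.2.1) ≤ R1 :=
    le_of_forall_pos_le_add fun δ hδ => (converse_step hp h hδ).1
  have hR12 : IT.condH p (fun v => (v.1, v.2.1)) (fun v => v.2.2) ≤ R1 + R2 :=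
    le_of_forall_pos_le_add fun δ hδ => (converse_step hp h hδ).2.1
  set C := IT.H p (fun v => v) - IT.H p (fun v => v.1) with hC
  obtain ⟨e, heK, he1, he2, he3, he4⟩ : ∃ e ∈ convexHull ℝ (SS p d1 d2), e.1 = m12 p ∧
      C ≤ R2 + e.2.1 ∧ e.2.2.1 ≤ D31 ∧ e.2.2.2 ≤ D12 := by
    have hcomp : IsCompact (convexHull ℝ (SS p d1 d2) ∩ {e | e.1 = m12 p}) :=
      (hull_compact (SS_compact p d1 d2) (ellE X1 X2) (ellE_SS p d1 d2)).inter_right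
        (isClosed_eq continuous_fst continuous_const)
    have hne : (convexHull ℝ (SS p d1 d2) ∩ {e | e.1 = m12 p}).Nonempty := by
      obtain ⟨_, _, F, D1, D2, hm, _⟩ := converse_step hp h one_pos
      exact ⟨_, hm, rfl⟩
    obtain ⟨e, ⟨he, he'⟩, hmin⟩ := hcomp.exists_isMinOn hne
      (f := fun e : EE X1 X2 => max (C - R2 - e.2.1) (max (e.2.2.1 - D31) (e.2.2.2 - D12)))
      (by apply Continuous.continuousOn; fun_prop)
    have hle : max (C - R2 - e.2.1) (max (e.2.2.1 - D31) (e.2.2.2 - D12)) ≤ 0 := by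
      refine le_of_forall_pos_le_add fun δ hδ => ?_
      obtain ⟨_, _, F, D1, D2, hm, h1, h2, h3⟩ := converse_step hp h hδ
      refine (hmin (show (m12 p, F, D1, D2) ∈ _ from ⟨hm, rfl⟩)).trans ?_
      simp only [max_le_iff]
      refine ⟨by linarith, by linarith, by linarith⟩
    simp only [max_le_iff] at hle
    exact ⟨e, he, he', by linarith, by linarith, by linarith⟩
  have key := hull_fin (ellE X1 X2) (ellE_SS p d1 d2) heK
  generalize hu : Module.finrank ℝ (EE X1 X2) = u at key
  obtain ⟨w, hw, z, hz, hsum⟩ := key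
  choose π hπ g31 g12 hzpt using hz
  set q : X1 × X2 × X3 × Fin u → ℝ := fun v => w v.2.2.2 * jt p (π v.2.2.2) (v.1, v.2.1, v.2.2.1) with hq
  have hq0 : ∀ v, 0 ≤ q v := fun v => mul_nonneg (hw.1 _) ((jt_pmf hp (hπ _)).1 _)
  have hqexp : ∀ (φ : X1 × X2 × X3 × Fin u → ℝ), ∑ v, q v * φ v =
      ∑ i, w i * ∑ y : X1 × X2 × X3, jt p (π i) y * φ (y.1, y.2.1, y.2.2, i) := by
    intro φ
    rw [sum4]
    simp only [hq, mul_assoc, Finset.mul_sum]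
  have hqpmf : IsPMF q := by
    refine ⟨hq0, ?_⟩
    have := hqexp (fun _ => 1)
    simp only [mul_one] at this
    rw [this]
    simp only [(jt_pmf hp (hπ _)).2, mul_one]
    exact hw.2
  have hs1 : ∀ ab, ∑ i, w i * π i ab = m12 p ab := by
    intro ab
    rw [← he1, ← hsum, Prod.fst_sum, Finset.sum_apply]
    refine Finset.sum_congr rfl fun i _ => ?_
    rw [hzpt i]; rfl
  have hs2 : ∑ i, w i * IT.condH (jt p (π i)) (fun v => v.2.2) (fun v => v.1) = e.2.1 := by
    rw [← hsum, Prod.snd_sum, Prod.fst_sum]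
    refine Finset.sum_congr rfl fun i _ => ?_
    rw [hzpt i]; rfl
  have hs3 : ∑ i, w i * IT.expect (jt p (π i)) (fun v => d1 v.1 (g31 i v.2.1 v.2.2)) = e.2.2.1 := by
    rw [← hsum, Prod.snd_sum, Prod.snd_sum, Prod.fst_sum]
    refine Finset.sum_congr rfl fun i _ => ?_
    rw [hzpt i]; rfl
  have hs4 : ∑ i, w i * IT.expect (jt p (π i)) (fun v => d2 v.2.1 (g12 i v.1)) = e.2.2.2 := by
    rw [← hsum, Prod.snd_sum, Prod.snd_sum, Prod.snd_sum]
    refine Finset.sum_congr rfl fun i _ => ?_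
    rw [hzpt i]; rfl
  have hmarg : ∀ a b c, (∑ d : Fin u, q (a, b, c, d)) = p (a, b, c) := by
    intro a b c
    simp only [hq, jt, ← mul_assoc]
    rw [← Finset.sum_mul, hs1, m12_mul_Wk hp]
  have hdist : ∀ y, IT.dist q (fun v => (v.1, v.2.1, v.2.2.1)) y = p y := by
    intro y
    unfold IT.dist
    rw [sum4, Finset.sum_comm, Finset.sum_eq_single y]
    · simp [hmarg]
    · intro y' _ hy'
      refine Finset.sum_eq_zero fun i _ => if_neg hy'
    · simp
  have hU : ∀ i, IT.dist q (fun v => v.2.2.2) i = w i := by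
    intro i
    unfold IT.dist
    rw [sum4, Finset.sum_eq_single i]
    · simp only [if_true, hq, ← Finset.mul_sum, (jt_pmf hp (hπ _)).2, mul_one]
    · intro i' _ h'
      simp [h']
    · simp
  have hZU : ∀ (y : X1 × X2 × X3) (i : Fin u), IT.dist q (fun v => ((v.1, v.2.1, v.2.2.1), v.2.2.2)) (y, i) =
      IT.dist q (fun v => v.2.2.2) i * jt p (π i) y := by
    intro y i
    rw [hU]
    unfold IT.dist
    rw [sum4, Finset.sum_eq_single i, Finset.sum_eq_single y]
    · simp [hq]
    · intro y' _ h'; rw [if_neg]; intro h; exact h' (Prod.mk.inj h).1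
    · simp
    · intro i' _ h'
      refine Finset.sum_eq_zero fun y' _ => if_neg ?_
      intro h; exact h' (Prod.mk.inj h).2
    · simp
  have hρ : ∀ i, ∑ y, jt p (π i) y = 1 := fun i => (jt_pmf hp (hπ i)).2
  have hF : IT.H q (fun v => ((v.2.2.1, v.1), v.2.2.2)) - IT.H q (fun v => (v.1, v.2.2.2)) = e.2.1 := by
    have h1 := mix_H q (fun v => v.2.2.2) (fun v => (v.1, v.2.1, v.2.2.1)) (fun i => jt p (π i)) hρ hZU (fun y => (y.2.2, y.1))
    have h2 := mix_H q (fun v => v.2.2.2) (fun v => (v.1, v.2.1, v.2.2.1)) (fun i => jt p (π i)) hρ hZU (fun y => y.1)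
    rw [h1, h2, ← hs2]
    simp only [hU, IT.condH, mul_sub, Finset.sum_sub_distrib]
    ring
  have hMarkov : IT.condMutInfo q (fun v => v.2.2.2) (fun v => v.2.2.1) (fun v => (v.1, v.2.1)) = 0 := by
    have hW : ∀ v : Fin u × (X1 × X2), ∑ c, Wk p v.2 c = 1 := fun v => Wk_sum p v.2
    have hd1 : ∀ c (v : Fin u × (X1 × X2)), IT.dist q (fun v => (v.2.2.1, (v.2.2.2, (v.1, v.2.1)))) (c, v) =
        IT.dist q (fun v => (v.2.2.2, (v.1, v.2.1))) v * Wk p v.2 c := by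
      rintro c ⟨i, a, b⟩
      have e1 : IT.dist q (fun v => (v.2.2.1, (v.2.2.2, (v.1, v.2.1)))) (c, i, a, b) = q (a, b, c, i) := by
        unfold IT.dist
        rw [Finset.sum_eq_single (a, b, c, i)]
        · simp
        · rintro ⟨a', b', c', i'⟩ _ h'
          rw [if_neg]
          intro h
          simp only [Prod.mk.injEq, ne_eq] at h h'
          tauto
        · simp
      have e2 : IT.dist q (fun v => (v.2.2.2, (v.1, v.2.1))) (i, a, b) = w i * π i (a, b) := by
        unfold IT.dist
        rw [sum4, Finset.sum_eq_single i, sum3, Finset.sum_eq_single (a, b)]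
        · simp only [if_true, hq, jt, ← Finset.mul_sum, Wk_sum, mul_one]
        · rintro ⟨a', b'⟩ _ h'
          refine Finset.sum_eq_zero fun c _ => if_neg ?_
          intro h; exact h' (Prod.mk.inj h).2
        · simp
        · intro i' _ h'
          refine Finset.sum_eq_zero fun y' _ => if_neg ?_
          intro h; exact h' (Prod.mk.inj h).1
        · simp
      rw [e1, e2]
      simp only [hq, jt]; ring
    have hd2 : ∀ c (v : X1 × X2), IT.dist q (fun v => (v.2.2.1, (v.1, v.2.1))) (c, v) =
        IT.dist q (fun v => (v.1, v.2.1)) v * Wk p v c := by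
      rintro c ⟨a, b⟩
      rw [dist_comp q _ _ hdist (fun y => (y.2.2, (y.1, y.2.1))), dist_comp q _ _ hdist (fun y => (y.1, y.2.1)),
        dist_12, m12_mul_Wk hp]
      unfold IT.dist
      rw [Finset.sum_eq_single (a, b, c)]
      · simp
      · rintro ⟨a', b', c'⟩ _ h'
        rw [if_neg]
        intro h
        simp only [Prod.mk.injEq, ne_eq] at h h'
        tauto
      · simp
    have h1 := mix_H q (fun v => (v.2.2.2, (v.1, v.2.1))) (fun v => v.2.2.1) (fun v => Wk p v.2) hW hd1 (fun c => c)
    have h2 := mix_H q (fun v => (v.1, v.2.1)) (fun v => v.2.2.1) (fun v => Wk p v) (Wk_sum p) hd2 (fun c => c)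
    rw [sum_dist_mul q _ (fun v : Fin u × (X1 × X2) => IT.H (Wk p v.2) (fun c => c))] at h1
    rw [sum_dist_mul q _ (fun v : X1 × X2 => IT.H (Wk p v) (fun c => c))] at h2
    have c1 : IT.H q (fun v => (v.2.2.1, (v.2.2.2, (v.1, v.2.1)))) = IT.H q (fun v => (v.2.2.2, v.2.2.1, v.1, v.2.1)) :=
      H_congr _ _ _ (fun _ _ => by simp only [Prod.mk.injEq]; tauto)
    unfold IT.condMutInfo IT.condH
    rw [← c1]
    dsimp only at h1 h2
    linarith
  have hHc := fun {β : Type} [Fintype β] (f : X1 × X2 × X3 → β) => H_comp q (fun v => (v.1, v.2.1, v.2.2.1)) p hdist f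
  refine ⟨u, le_of_eq (hu.symm.trans finrank_EE), q, hqpmf, hmarg, hMarkov, fun b c i => g31 i b c, fun a i => g12 i a, ?_, ?_, ?_, ?_, ?_⟩
  · refine le_trans (le_of_eq ?_) he3
    rw [← hs3]
    unfold IT.expect
    rw [hqexp]
  · refine le_trans (le_of_eq ?_) he4
    rw [← hs4]
    unfold IT.expect
    rw [hqexp]
  · refine le_trans (le_of_eq ?_) hR1
    unfold IT.condH
    rw [hHc (fun y => (y.1, y.2.1)), hHc (fun y => y.2.1)]
  · rw [rate2_identity, hMarkov, hF, hHc (fun y => y), hHc (fun y => y.1)]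
    linarith
  · refine le_trans (le_of_eq ?_) hR12
    unfold IT.condH
    rw [hHc (fun y => ((y.1, y.2.1), y.2.2)), hHc (fun y => y.2.2)]

end conv
end TE

namespace TE
open Classical in
theorem exists_le_avg {Θ : Type*} [Fintype Θ] (w X : Θ → ℝ) (hw : ∀ θ, 0 ≤ w θ) (hs : ∑ θ, w θ = 1) :
    ∃ θ, X θ ≤ ∑ θ, w θ * X θ := by
  by_contra hcon
  push Not at hcon
  set B := ∑ θ, w θ * X θ with hB
  have h1 : ∑ θ, w θ * (X θ - B) = 0 := by
    simp only [mul_sub, Finset.sum_sub_distrib, ← Finset.sum_mul, hs, ← hB]; ring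
  have h2 : ∀ θ ∈ Finset.univ, 0 ≤ w θ * (X θ - B) := fun θ _ =>
    mul_nonneg (hw θ) (by linarith [hcon θ])
  have h3 := (Finset.sum_eq_zero_iff_of_nonneg h2).1 h1
  have h4 : ∀ θ, w θ = 0 := by
    intro θ
    have := h3 θ (Finset.mem_univ _)
    rcases mul_eq_zero.1 this with h | h
    · exact h
    · have := hcon θ; linarith
  simp [h4] at hs

theorem exp_conv {s y : ℝ} (h0 : 0 ≤ s) (h1 : s ≤ 1) : Real.exp (s * y) ≤ 1 - s + Real.exp y := by
  have := convexOn_exp.2 (Set.mem_univ (0:ℝ)) (Set.mem_univ y) (sub_nonneg.2 h1) h0 (by ring)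
  simp only [smul_eq_mul, mul_zero, zero_add, Real.exp_zero, mul_one] at this
  have h2 : s * Real.exp y ≤ Real.exp y := mul_le_of_le_one_left (Real.exp_pos _).le h1
  linarith

open Classical in
/-- one-letter covering -/
theorem cover1 {B V : Type*} {M : ℕ} [Fintype B] [Fintype V] [Nonempty V]
    (μ : B → ℝ) (hμ : ∀ b, 0 ≤ μ b) (κ : B → V → ℝ) (hκ : ∀ b v, 0 ≤ κ b v)
    (hκ1 : ∀ b, ∑ v, κ b v ≤ 1) (lam : V → ℝ) (hl : ∀ v, 0 ≤ lam v) (hl1 : ∑ v, lam v ≤ 1)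
    (G : B → V → Prop) (Γ : ℝ) (hΓ : 0 < Γ)
    (hG : ∀ b v, 0 < μ b → G b v → κ b v ≤ Γ * lam v) :
    ∃ c : Fin M → V, ∑ b, (if ∀ m, ¬ G b (c m) then μ b else 0) ≤
      ∑ b, μ b * (1 - (∑ v, if G b v then κ b v else 0) + Real.exp (-(M / Γ))) := by
  obtain ⟨v0⟩ := ‹Nonempty V›
  set l' : V → ℝ := fun v => lam v + (if v = v0 then 1 - ∑ v, lam v else 0) with hl'
  have hl'0 : ∀ v, lam v ≤ l' v := by
    intro v; simp only [hl']; split_ifs <;> linarith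
  have hl'1 : ∑ v, l' v = 1 := by
    simp [hl', Finset.sum_add_distrib]
  have hl'n : ∀ v, 0 ≤ l' v := fun v => (hl v).trans (hl'0 v)
  have hw : ∑ c : Fin M → V, ∏ m, l' (c m) = 1 := by
    rw [sum_prod_pi (fun (_ : Fin M) a => l' a)]; simp [hl'1]
  obtain ⟨c, hc⟩ := exists_le_avg (fun c : Fin M → V => ∏ m, l' (c m))
    (fun c => ∑ b, (if ∀ m, ¬ G b (c m) then μ b else 0))
    (fun c => Finset.prod_nonneg fun m _ => hl'n _) hw
  refine ⟨c, hc.trans ?_⟩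
  simp only [Finset.mul_sum]
  rw [Finset.sum_comm]
  refine Finset.sum_le_sum fun b _ => ?_
  have e1 : ∑ c : Fin M → V, (∏ m, l' (c m)) * (if ∀ m, ¬ G b (c m) then μ b else 0) =
      μ b * (∑ v, if G b v then 0 else l' v) ^ M := by
    have : (∑ v, if G b v then 0 else l' v) ^ M =
        ∑ c : Fin M → V, ∏ m, (if G b (c m) then 0 else l' (c m)) := by
      rw [sum_prod_pi (fun (_ : Fin M) a => if G b a then 0 else l' a)]; simp
    rw [this, Finset.mul_sum]
    refine Finset.sum_congr rfl fun c _ => ?_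
    by_cases h : ∀ m, ¬ G b (c m)
    · rw [if_pos h, mul_comm]; congr 1
      exact Finset.prod_congr rfl fun m _ => by simp [h m]
    · rw [if_neg h]
      push Not at h
      obtain ⟨m, hm⟩ := h
      have h0 : (∏ m, (if G b (c m) then 0 else l' (c m))) = 0 :=
        Finset.prod_eq_zero (Finset.mem_univ m) (if_pos hm)
      rw [h0]; simp
  rw [e1]
  rcases (hμ b).eq_or_lt with h | hpos
  · simp [← h]
  refine mul_le_mul_of_nonneg_left ?_ (hμ b)
  set s := ∑ v, if G b v then κ b v else 0
  set g := ∑ v, if G b v then l' v else 0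
  have hg : (∑ v, if G b v then 0 else l' v) = 1 - g := by
    rw [eq_sub_iff_add_eq, ← Finset.sum_add_distrib, ← hl'1]
    exact Finset.sum_congr rfl fun v _ => by split_ifs <;> simp
  have hsg : s ≤ Γ * g := by
    rw [Finset.mul_sum]
    refine Finset.sum_le_sum fun v _ => ?_
    split_ifs with h
    · exact (hG b v hpos h).trans (mul_le_mul_of_nonneg_left (hl'0 v) hΓ.le)
    · simp
  have hs0 : 0 ≤ s := Finset.sum_nonneg fun v _ => by split_ifs; exacts [hκ _ _, le_rfl]
  have hs1 : s ≤ 1 := (Finset.sum_le_sum fun v _ => by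
    split_ifs; exacts [le_rfl, hκ _ _]).trans (hκ1 b)
  have hg1 : 0 ≤ 1 - g := by
    rw [← hg]; exact Finset.sum_nonneg fun v _ => by split_ifs; exacts [le_rfl, hl'n _]
  rw [hg]
  calc (1 - g) ^ M ≤ (Real.exp (-g)) ^ M :=
        pow_le_pow_left₀ hg1 (by linarith [Real.add_one_le_exp (-g)]) _
    _ = Real.exp (-(M * g)) := by rw [← Real.exp_nat_mul]; congr 1; ring
    _ ≤ Real.exp (s * -(M / Γ)) := by
        refine Real.exp_le_exp.2 ?_
        have : s / Γ ≤ g := by rw [div_le_iff₀ hΓ]; linarith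
        have := mul_le_mul_of_nonneg_left this (Nat.cast_nonneg (α := ℝ) M)
        have e : s * -(M / Γ) = -(M * (s / Γ)) := by ring
        rw [e]; linarith
    _ ≤ _ := exp_conv hs0 hs1

open Classical in
theorem cover {A B C V : Type*} {M : ℕ} [Fintype A] [Fintype B] [Fintype C] [Fintype V]
    [Nonempty V] [NeZero M]
    (P : A → B → C → ℝ) (hP : ∀ a b c, 0 ≤ P a b c) (hP1 : ∑ a, ∑ b, ∑ c, P a b c = 1)
    (κ : A → B → V → ℝ) (hκ : ∀ a b v, 0 ≤ κ a b v)
    (hκ1 : ∀ a b, ∑ v, κ a b v ≤ 1)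
    (htot : ∑ a, ∑ b, ∑ c, ∑ v, P a b c * κ a b v = 1)
    (lam : A → V → ℝ) (hl : ∀ a v, 0 ≤ lam a v) (hl1 : ∀ a, ∑ v, lam a v ≤ 1)
    (T : A → B → C → V → Prop) (η τ Γ : ℝ) (hτ0 : 0 < τ) (hτ1 : τ < 1) (hΓ : 0 < Γ)
    (hη : ∑ a, ∑ b, ∑ c, ∑ v, (if T a b c v then 0 else P a b c * κ a b v) ≤ η)
    (hT : ∀ a b c v, T a b c v → κ a b v ≤ Γ * lam a v) :
    ∃ (cb : A → Fin M → V) (f : A → B → Fin M),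
      ∑ a, ∑ b, ∑ c, (if T a b c (cb a (f a b)) then 0 else P a b c) ≤
        η / τ + τ + Real.exp (-(M / Γ)) := by
  set μ : A → B → ℝ := fun a b => ∑ c, P a b c with hμd
  have hμ : ∀ a b, 0 ≤ μ a b := fun a b => Finset.sum_nonneg fun c _ => hP _ _ _
  set bad : A → B → V → ℝ := fun a b v => ∑ c, if T a b c v then 0 else P a b c with hbad
  set G : A → B → V → Prop := fun a b v => bad a b v ≤ τ * μ a b with hGd
  have hG : ∀ a b v, 0 < μ a b → G a b v → κ a b v ≤ Γ * lam a v := by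
    intro a b v hpos hg
    by_contra hcon
    have : bad a b v = μ a b := by
      refine Finset.sum_congr rfl fun c _ => if_neg fun h => hcon (hT _ _ _ _ h)
    rw [hGd] at hg
    simp only [this] at hg
    nlinarith
  choose cb hcb using fun a => cover1 (M := M) (μ a) (hμ a) (κ a) (hκ a) (hκ1 a) (lam a) (hl a) (hl1 a)
    (G a) Γ hΓ (hG a)
  set f : A → B → Fin M := fun a b => if h : ∃ m, G a b (cb a m) then h.choose else 0 with hf
  refine ⟨cb, f, ?_⟩
  have hfs : ∀ a b, bad a b (cb a (f a b)) ≤ (if ∀ m, ¬ G a b (cb a m) then μ a b else 0) + τ * μ a b := by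
    intro a b
    by_cases h : ∃ m, G a b (cb a m)
    · have h1 : G a b (cb a (f a b)) := by
        simp only [hf, dif_pos h]; exact h.choose_spec
      have h2 : ¬ ∀ m, ¬ G a b (cb a m) := by push Not; exact h
      rw [if_neg h2, zero_add]; exact h1
    · push Not at h
      rw [if_pos h]
      have : bad a b (cb a (f a b)) ≤ μ a b := Finset.sum_le_sum fun c _ => by
        split_ifs; exacts [hP _ _ _, le_rfl]
      have := mul_nonneg hτ0.le (hμ a b)
      linarith
  set e := Real.exp (-(M / Γ))
  have hμ1 : ∑ a, ∑ b, μ a b = 1 := hP1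
  have hκ' : ∀ a b, τ * (∑ v, μ a b * (if G a b v then 0 else κ a b v)) ≤
      ∑ c, ∑ v, (if T a b c v then 0 else P a b c * κ a b v) := by
    intro a b
    rw [Finset.sum_comm, Finset.mul_sum]
    refine Finset.sum_le_sum fun v _ => ?_
    have e1 : ∑ c, (if T a b c v then 0 else P a b c * κ a b v) = bad a b v * κ a b v := by
      rw [hbad, Finset.sum_mul]
      exact Finset.sum_congr rfl fun c _ => by split_ifs <;> simp
    rw [e1]
    split_ifs with h
    · simp only [mul_zero]
      exact mul_nonneg (Finset.sum_nonneg fun c _ => by split_ifs; exacts [le_rfl, hP _ _ _]) (hκ _ _ _)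
    · have : τ * μ a b ≤ bad a b v := le_of_lt (not_le.1 h)
      rw [← mul_assoc]
      exact mul_le_mul_of_nonneg_right this (hκ _ _ _)
  have hsplit : ∀ a b, μ a b * (1 - (∑ v, if G a b v then κ a b v else 0) + e) =
      μ a b + e * μ a b - (∑ c, ∑ v, P a b c * κ a b v) + ∑ v, μ a b * (if G a b v then 0 else κ a b v) := by
    intro a b
    have e1 : ∑ c, ∑ v, P a b c * κ a b v = μ a b * ∑ v, κ a b v := by
      rw [hμd, Finset.sum_mul]; simp only [Finset.mul_sum]
    have e2 : ∑ v, κ a b v = (∑ v, if G a b v then κ a b v else 0) + ∑ v, (if G a b v then 0 else κ a b v) := by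
      rw [← Finset.sum_add_distrib]
      exact Finset.sum_congr rfl fun c _ => by split_ifs <;> simp
    rw [e1, e2, ← Finset.mul_sum]; ring
  have hR : ∑ a, ∑ b, μ a b * (1 - (∑ v, if G a b v then κ a b v else 0) + e) ≤ e + η / τ := by
    simp only [hsplit, Finset.sum_add_distrib, Finset.sum_sub_distrib, ← Finset.mul_sum, hμ1]
    simp only [← Finset.mul_sum] at htot
    rw [htot]
    have : τ * (∑ a, ∑ b, ∑ v, μ a b * (if G a b v then 0 else κ a b v)) ≤ η := by
      refine le_trans ?_ hη
      rw [Finset.mul_sum]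
      refine Finset.sum_le_sum fun a _ => ?_
      rw [Finset.mul_sum]
      exact Finset.sum_le_sum fun b _ => hκ' a b
    have := (le_div_iff₀' hτ0).2 this
    simp only [← Finset.mul_sum] at this
    linarith
  calc ∑ a, ∑ b, ∑ c, (if T a b c (cb a (f a b)) then 0 else P a b c)
      = ∑ a, ∑ b, bad a b (cb a (f a b)) := rfl
    _ ≤ ∑ a, ∑ b, ((if ∀ m, ¬ G a b (cb a m) then μ a b else 0) + τ * μ a b) :=
        Finset.sum_le_sum fun a _ => Finset.sum_le_sum fun b _ => hfs a b
    _ = (∑ a, ∑ b, (if ∀ m, ¬ G a b (cb a m) then μ a b else 0)) + τ := by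
        simp only [Finset.sum_add_distrib, ← Finset.mul_sum, hμ1, mul_one]
    _ ≤ (∑ a, ∑ b, μ a b * (1 - (∑ v, if G a b v then κ a b v else 0) + e)) + τ := by
        have := Finset.sum_le_sum fun a (_ : a ∈ Finset.univ) => hcb a
        linarith
    _ ≤ _ := by linarith

end TE

namespace TE
open Classical in
/-- Indicator of a proposition. -/
def ind (Q : Prop) : ℝ := if Q then 1 else 0

theorem ind_pos {Q : Prop} (h : Q) : ind Q = 1 := by simp [ind, h]
theorem ind_neg {Q : Prop} (h : ¬ Q) : ind Q = 0 := by simp [ind, h]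
theorem ind_nonneg (Q : Prop) : 0 ≤ ind Q := by unfold ind; split_ifs <;> simp
theorem ind_le_one (Q : Prop) : ind Q ≤ 1 := by unfold ind; split_ifs <;> simp
theorem ind_and (Q R : Prop) : ind (Q ∧ R) = ind Q * ind R := by
  by_cases h1 : Q <;> by_cases h2 : R <;> simp [ind, h1, h2]
theorem ind_mono {Q R : Prop} (h : Q → R) : ind Q ≤ ind R := by
  by_cases h1 : Q
  · rw [ind_pos h1, ind_pos (h h1)]
  · rw [ind_neg h1]; exact ind_nonneg _
theorem ind_or (Q R : Prop) : ind (Q ∨ R) ≤ ind Q + ind R := by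
  by_cases h1 : Q <;> by_cases h2 : R <;> simp [ind, h1, h2]
theorem ind_exists {I : Type*} [Fintype I] (E : I → Prop) : ind (∃ i, E i) ≤ ∑ i, ind (E i) := by
  by_cases h : ∃ i, E i
  · obtain ⟨i, hi⟩ := h
    rw [ind_pos ⟨i, hi⟩, ← ind_pos hi]
    exact Finset.single_le_sum (f := fun i => ind (E i)) (fun i _ => ind_nonneg _) (Finset.mem_univ i)
  · rw [ind_neg h]; exact Finset.sum_nonneg fun i _ => ind_nonneg _

theorem coll {A I : Type*} [Fintype A] [DecidableEq A] [Fintype I] [Nonempty I] (a a' : A) (hne : a' ≠ a) (g : I → I) :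
    ∑ h : A → I, (1 / (Fintype.card (A → I) : ℝ)) * ind (h a' = g (h a)) ≤ 1 / (Fintype.card I : ℝ) := by
  classical
  have hcard : (Finset.univ.filter fun h : A → I => h a' = g (h a)).card * Fintype.card I ≤ Fintype.card (A → I) := by
    rw [← Fintype.card_subtype, ← Fintype.card_prod]
    refine Fintype.card_le_of_injective
      (fun x : {h : A → I // h a' = g (h a)} × I => Function.update x.1.1 a' x.2) ?_
    rintro ⟨⟨h, hh⟩, m⟩ ⟨⟨k, hk⟩, m'⟩ he
    have h1 : m = m' := by simpa using congrFun he a'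
    have h2 : ∀ x, x ≠ a' → h x = k x := fun x hx => by
      simpa [Function.update_of_ne hx] using congrFun he x
    have h3 : h = k := by
      funext x
      by_cases hx : x = a'
      · rw [hx, hh, hk, h2 a hne.symm]
      · exact h2 x hx
    subst h1 h3; rfl
  unfold ind
  rw [← Finset.mul_sum, Finset.sum_boole]
  have hI : (0:ℝ) < Fintype.card I := by exact_mod_cast Fintype.card_pos
  have hAI : (0:ℝ) < Fintype.card (A → I) := by exact_mod_cast Fintype.card_pos
  rw [one_div_mul_eq_div, div_le_div_iff₀ hAI hI, one_mul]
  convert (Nat.cast_le (α := ℝ)).2 hcard using 1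
  push_cast
  congr!

/-- average over a uniformly random triple -/
def avg3 {Θ1 Θ2 Θ3 : Type*} [Fintype Θ1] [Fintype Θ2] [Fintype Θ3] (φ : Θ1 → Θ2 → Θ3 → ℝ) : ℝ :=
  ∑ x, ∑ y, ∑ z, (1 / (Fintype.card Θ1 : ℝ)) * (1 / (Fintype.card Θ2 : ℝ)) * (1 / (Fintype.card Θ3 : ℝ)) * φ x y z

section
variable {Θ1 Θ2 Θ3 : Type*} [Fintype Θ1] [Fintype Θ2] [Fintype Θ3]

theorem avg3_mono {φ ψ : Θ1 → Θ2 → Θ3 → ℝ} (h : ∀ x y z, φ x y z ≤ ψ x y z) : avg3 φ ≤ avg3 ψ :=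
  Finset.sum_le_sum fun x _ => Finset.sum_le_sum fun y _ => Finset.sum_le_sum fun z _ =>
    mul_le_mul_of_nonneg_left (h x y z) (by positivity)

theorem avg3_sum {I : Type*} (s : Finset I) (φ : I → Θ1 → Θ2 → Θ3 → ℝ) :
    avg3 (fun x y z => ∑ i ∈ s, φ i x y z) = ∑ i ∈ s, avg3 (φ i) := by
  unfold avg3
  rw [Finset.sum_comm (s := s)]
  refine Finset.sum_congr rfl fun x _ => ?_
  rw [Finset.sum_comm (s := s)]
  refine Finset.sum_congr rfl fun y _ => ?_
  rw [Finset.sum_comm (s := s)]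
  refine Finset.sum_congr rfl fun z _ => ?_
  rw [Finset.mul_sum]

theorem avg3_add (φ ψ : Θ1 → Θ2 → Θ3 → ℝ) :
    avg3 (fun x y z => φ x y z + ψ x y z) = avg3 φ + avg3 ψ := by
  unfold avg3
  simp only [mul_add, Finset.sum_add_distrib]

theorem avg3_mul (k : ℝ) (φ : Θ1 → Θ2 → Θ3 → ℝ) :
    avg3 (fun x y z => k * φ x y z) = k * avg3 φ := by
  unfold avg3
  simp only [Finset.mul_sum]
  refine Finset.sum_congr rfl fun x _ => Finset.sum_congr rfl fun y _ => Finset.sum_congr rfl fun z _ => by ring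

theorem avg3_prod (φ : Θ1 → ℝ) (ψ : Θ2 → ℝ) (χ : Θ3 → ℝ) :
    avg3 (fun x y z => φ x * ψ y * χ z) = (∑ x, (1 / (Fintype.card Θ1 : ℝ)) * φ x) *
      (∑ x, (1 / (Fintype.card Θ2 : ℝ)) * ψ x) * (∑ x, (1 / (Fintype.card Θ3 : ℝ)) * χ x) := by
  unfold avg3
  symm
  rw [Finset.sum_mul, Finset.sum_mul]
  refine Finset.sum_congr rfl fun h _ => ?_
  rw [mul_assoc, Finset.sum_mul, Finset.mul_sum]
  refine Finset.sum_congr rfl fun h' _ => ?_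
  rw [Finset.mul_sum, Finset.mul_sum]
  exact Finset.sum_congr rfl fun h'' _ => by ring

theorem unif_sum (I : Type*) [Fintype I] [Nonempty I] : ∑ _h : I, (1 / (Fintype.card I : ℝ)) * 1 = 1 := by
  simp

theorem avg3_exists [Nonempty Θ1] [Nonempty Θ2] [Nonempty Θ3] (φ : Θ1 → Θ2 → Θ3 → ℝ) :
    ∃ x y z, φ x y z ≤ avg3 φ := by
  have h1 := avg3_prod (Θ1 := Θ1) (Θ2 := Θ2) (Θ3 := Θ3) (fun _ => 1) (fun _ => 1) (fun _ => 1)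
  rw [unif_sum, unif_sum, unif_sum] at h1
  unfold avg3 at h1
  obtain ⟨θ, hθ⟩ := exists_le_avg (fun _ : Θ1 × Θ2 × Θ3 => (1 / (Fintype.card Θ1 : ℝ)) * (1 / (Fintype.card Θ2 : ℝ)) * (1 / (Fintype.card Θ3 : ℝ)))
    (fun θ => φ θ.1 θ.2.1 θ.2.2) (fun _ => by positivity) (by
      rw [Fintype.sum_prod_type]; simp only [Fintype.sum_prod_type]; simpa using h1)
  refine ⟨θ.1, θ.2.1, θ.2.2, hθ.trans (le_of_eq ?_)⟩
  rw [Fintype.sum_prod_type]; simp only [Fintype.sum_prod_type]; rfl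
end

theorem ind_sum_le {I : Type*} [Fintype I] (S : I → Prop) (Y : I → ℝ) {N k : ℝ} (hk : 0 ≤ k)
    (hN : ∑ i, ind (S i) ≤ N) (hY : ∀ i, Y i ≤ k) :
    ∑ i, ind (S i) * Y i ≤ N * k := by
  calc _ ≤ ∑ i, ind (S i) * k := Finset.sum_le_sum fun i _ => mul_le_mul_of_nonneg_left (hY i) (ind_nonneg _)
    _ = (∑ i, ind (S i)) * k := by rw [Finset.sum_mul]
    _ ≤ _ := mul_le_mul_of_nonneg_right hN hk

section
variable {A B C V : Type*} {M1 M Mb : ℕ} 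

/-- the decoding-failure events -/
def ev1 (T : A → B → C → V → Prop) (h1 : A → Fin M1) (a : A) (b : B) : Prop :=
  ∃ a', (∃ c v, T a' b c v) ∧ (a' ≠ a ∧ h1 a' = h1 a)

def ev2 (T : A → B → C → V → Prop) (cb : A → Fin M → V) (f : A → B → Fin M)
    (h1 : A → Fin M1) (s : A → Fin M) (hb : A × B → Fin Mb) (a : A) (b : B) (c : C) : Prop :=
  ∃ ab : A × B, T ab.1 ab.2 c (cb ab.1 (f ab.1 ab.2)) ∧ ab ≠ (a, b) ∧ h1 ab.1 = h1 a ∧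
          f ab.1 ab.2 + s ab.1 = f a b + s a ∧ hb ab = hb (a, b)

variable [Fintype A] [Fintype B] [NeZero M1] [NeZero M] [NeZero Mb]
theorem hash_letter [DecidableEq A] [DecidableEq B] (T : A → B → C → V → Prop) (N1 N2 N3 : ℝ)
    (hN1 : ∀ b, ∑ a, ind (∃ c v, T a b c v) ≤ N1)
    (hN2 : ∀ a c v, ∑ b, ind (T a b c v) ≤ N2)
    (hN3 : ∀ c, ∑ ab : A × B, ind (∃ v, T ab.1 ab.2 c v) ≤ N3)
    (cb : A → Fin M → V) (f : A → B → Fin M) (a : A) (b : B) (c : C) :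
    avg3 (fun (h1 : A → Fin M1) (s : A → Fin M) (hb : A × B → Fin Mb) =>
      ind (ev1 T h1 a b) + ind (ev2 T cb f h1 s hb a b c)) ≤
    N1 * (1 / M1) + (N2 * (1 / Mb) + N3 * (1 / (M1 * M * Mb))) := by
  have hc1 : (0:ℝ) ≤ 1 / M1 := by positivity
  have hc2 : (0:ℝ) ≤ 1 / M := by positivity
  have hc3 : (0:ℝ) ≤ 1 / Mb := by positivity
  rw [avg3_add]
  refine add_le_add ?_ ?_
  · calc _ ≤ avg3 (fun (h1 : A → Fin M1) (s : A → Fin M) (hb : A × B → Fin Mb) =>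
          ∑ a', ind (∃ c v, T a' b c v) * ind (a' ≠ a ∧ h1 a' = h1 a)) := by
          refine avg3_mono fun h1 s hb => (ind_exists _).trans (le_of_eq ?_)
          exact Finset.sum_congr rfl fun a' _ => ind_and _ _
      _ ≤ _ := by
          rw [avg3_sum]
          simp only [avg3_mul]
          refine ind_sum_le _ _ hc1 (hN1 b) fun a' => ?_
          have := avg3_prod (Θ1 := A → Fin M1) (Θ2 := A → Fin M) (Θ3 := A × B → Fin Mb)
            (fun h1 => ind (a' ≠ a ∧ h1 a' = h1 a)) (fun _ => 1) (fun _ => 1)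
          rw [unif_sum, unif_sum] at this
          simp only [mul_one] at this
          rw [this]
          by_cases hne : a' = a
          · simp only [ne_eq, hne, not_true_eq_false, false_and, ind_neg not_false, mul_zero, Finset.sum_const_zero]
            exact hc1
          · simpa [hne] using coll (I := Fin M1) a a' hne id
  · calc _ ≤ avg3 (fun (h1 : A → Fin M1) (s : A → Fin M) (hb : A × B → Fin Mb) =>
          (∑ b', ind (T a b' c (cb a (f a b))) * ind (b' ≠ b ∧ hb (a, b') = hb (a, b))) +
          (∑ ab : A × B, ind (∃ v, T ab.1 ab.2 c v) * ind (ab.1 ≠ a ∧ h1 ab.1 = h1 a ∧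
          s ab.1 = f a b + s a - f ab.1 ab.2 ∧ hb ab = hb (a, b)))) := by
          refine avg3_mono fun h1 s hb => ?_
          have i2 := (ind_exists (fun b' => T a b' c (cb a (f a b)) ∧ (b' ≠ b ∧ hb (a, b') = hb (a, b))))
          have i3 := (ind_exists (fun ab : A × B => (∃ v, T ab.1 ab.2 c v) ∧ (ab.1 ≠ a ∧ h1 ab.1 = h1 a ∧
            s ab.1 = f a b + s a - f ab.1 ab.2 ∧ hb ab = hb (a, b))))
          simp only [ind_and (T a _ c (cb a (f a b)))] at i2
          simp only [ind_and (∃ v, T _ _ c v)] at i3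
          refine le_trans ?_ (add_le_add i2 i3)
          refine (ind_mono ?_).trans (ind_or _ _)
          rintro ⟨⟨a', b'⟩, hT, hne, e1, e2, e3⟩
          dsimp only at hT e1 e2 e3
          by_cases haa : a' = a
          · left
            subst haa
            have hf : f a' b' = f a' b := add_right_cancel e2
            rw [hf] at hT
            exact ⟨b', hT, fun h => hne (by rw [h]), e3⟩
          · right
            exact ⟨(a', b'), ⟨_, hT⟩, haa, e1, by rw [← e2]; simp, e3⟩
      _ ≤ _ := by
          rw [avg3_add, avg3_sum, avg3_sum]
          simp only [avg3_mul]
          refine add_le_add ?_ ?_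
          · refine ind_sum_le _ _ hc3 (hN2 a c _) fun b' => ?_
            have := avg3_prod (Θ1 := A → Fin M1) (Θ2 := A → Fin M) (Θ3 := A × B → Fin Mb)
              (fun _ => 1) (fun _ => 1) (fun hb => ind (b' ≠ b ∧ hb (a, b') = hb (a, b)))
            rw [unif_sum, unif_sum] at this
            simp only [one_mul] at this
            rw [this]
            by_cases hne : b' = b
            · simp only [ne_eq, hne, not_true_eq_false, false_and, ind_neg not_false, mul_zero, Finset.sum_const_zero]
              exact hc3
            · simpa [hne] using coll (I := Fin Mb) (a, b) (a, b') (by simpa using hne) id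
          · refine ind_sum_le _ _ (by positivity) (hN3 c) ?_
            rintro ⟨a', b'⟩
            dsimp only
            have := avg3_prod (Θ1 := A → Fin M1) (Θ2 := A → Fin M) (Θ3 := A × B → Fin Mb)
              (fun h1 => ind (a' ≠ a ∧ h1 a' = h1 a)) (fun s => ind (s a' = f a b + s a - f a' b'))
                (fun hb => ind (hb (a', b') = hb (a, b)))
            simp only [← ind_and, and_assoc] at this
            rw [this]
            by_cases hne : a' = a
            · simp only [ne_eq, hne, not_true_eq_false, false_and, ind_neg not_false, mul_zero, Finset.sum_const_zero, zero_mul]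
              positivity
            have k1 := coll (I := Fin M1) a a' hne id
            have k2 := coll (I := Fin M) a a' hne (fun i => f a b + i - f a' b')
            have k3 := coll (I := Fin Mb) (a, b) (a', b') (fun h => hne (Prod.mk.inj h).1) id
            simp only [id] at k1 k2 k3
            rw [Fintype.card_fin] at k1 k2 k3
            have n2 : 0 ≤ ∑ s : A → Fin M, 1 / (Fintype.card (A → Fin M) : ℝ) * ind (s a' = f a b + s a - f a' b') :=
              Finset.sum_nonneg fun s _ => mul_nonneg (by positivity) (ind_nonneg _)
            have n3 : 0 ≤ ∑ s : A × B → Fin Mb, 1 / (Fintype.card (A × B → Fin Mb) : ℝ) * ind (s (a', b') = s (a, b)) :=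
              Finset.sum_nonneg fun s _ => mul_nonneg (by positivity) (ind_nonneg _)
            simp only [ne_eq, hne, not_false_eq_true, true_and]
            calc _ ≤ (1 / (M1:ℝ)) * (1 / M) * (1 / Mb) :=
                  mul_le_mul (mul_le_mul k1 k2 n2 hc1) k3 n3 (by positivity)
              _ = _ := by rw [one_div_mul_one_div, one_div_mul_one_div]

theorem hashing [Fintype C]
    (P : A → B → C → ℝ) (hP : ∀ a b c, 0 ≤ P a b c) (hP1 : ∑ a, ∑ b, ∑ c, P a b c = 1)
    (T : A → B → C → V → Prop) (N1 N2 N3 : ℝ)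
    (hN1 : ∀ b, ∑ a, ind (∃ c v, T a b c v) ≤ N1)
    (hN2 : ∀ a c v, ∑ b, ind (T a b c v) ≤ N2)
    (hN3 : ∀ c, ∑ ab : A × B, ind (∃ v, T ab.1 ab.2 c v) ≤ N3)
    (cb : A → Fin M → V) (f : A → B → Fin M) :
    ∃ (h1 : A → Fin M1) (s : A → Fin M) (hb : A × B → Fin Mb),
      ∑ a, ∑ b, ∑ c, P a b c * (ind (ev1 T h1 a b) + ind (ev2 T cb f h1 s hb a b c)) ≤
      N1 * (1 / M1) + (N2 * (1 / Mb) + N3 * (1 / (M1 * M * Mb))) := by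
  classical
  obtain ⟨h1, s, hb, h⟩ := avg3_exists (fun (h1 : A → Fin M1) (s : A → Fin M) (hb : A × B → Fin Mb) =>
    ∑ a, ∑ b, ∑ c, P a b c * (ind (ev1 T h1 a b) + ind (ev2 T cb f h1 s hb a b c)))
  refine ⟨h1, s, hb, h.trans ?_⟩
  simp only [avg3_sum, avg3_mul]
  set Bd := N1 * (1 / M1) + (N2 * (1 / Mb) + N3 * (1 / (M1 * M * Mb)))
  calc _ ≤ ∑ a, ∑ b, ∑ c, P a b c * Bd := Finset.sum_le_sum fun a _ => Finset.sum_le_sum fun b _ =>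
        Finset.sum_le_sum fun c _ => mul_le_mul_of_nonneg_left (hash_letter T N1 N2 N3 hN1 hN2 hN3 cb f a b c) (hP a b c)
    _ = Bd := by simp only [← Finset.sum_mul, hP1, one_mul]

end

end TE

namespace TE

theorem oneshot {A B C V : Type*} {M1 M Mb : ℕ} [Fintype A] [Fintype B] [Fintype C] [Fintype V]
    [Nonempty A] [Nonempty B] [Nonempty V] [NeZero M1] [NeZero M] [NeZero Mb]
    (P : A → B → C → ℝ) (hP : ∀ a b c, 0 ≤ P a b c) (hP1 : ∑ a, ∑ b, ∑ c, P a b c = 1)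
    (κ : A → B → V → ℝ) (hκ : ∀ a b v, 0 ≤ κ a b v)
    (hκ1 : ∀ a b, ∑ v, κ a b v ≤ 1)
    (htot : ∑ a, ∑ b, ∑ c, ∑ v, P a b c * κ a b v = 1)
    (lam : A → V → ℝ) (hl : ∀ a v, 0 ≤ lam a v) (hl1 : ∀ a, ∑ v, lam a v ≤ 1)
    (T : A → B → C → V → Prop) (η τ Γ : ℝ) (hτ0 : 0 < τ) (hτ1 : τ < 1) (hΓ : 0 < Γ)
    (hη : ∑ a, ∑ b, ∑ c, ∑ v, ind (¬ T a b c v) * (P a b c * κ a b v) ≤ η)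
    (hT : ∀ a b c v, T a b c v → κ a b v ≤ Γ * lam a v) (N1 N2 N3 : ℝ)
    (hN1 : ∀ b, ∑ a, ind (∃ c v, T a b c v) ≤ N1)
    (hN2 : ∀ a c v, ∑ b, ind (T a b c v) ≤ N2)
    (hN3 : ∀ c, ∑ ab : A × B, ind (∃ v, T ab.1 ab.2 c v) ≤ N3) :
    ∃ (h1 : A → Fin M1) (dec2 : B → Fin M1 → A) (enc2 : B → A → Fin M × Fin Mb)
      (dec1 : A → Fin M × Fin Mb → V) (dec3 : C → Fin M1 → Fin M × Fin Mb → A × B × V),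
      ∑ a, ∑ b, ∑ c, P a b c * ind (¬ ∃ v, T a b c v ∧ dec2 b (h1 a) = a ∧ dec1 a (enc2 b a) = v ∧
        dec3 c (h1 a) (enc2 b a) = (a, b, v)) ≤
      η / τ + τ + Real.exp (-(M / Γ)) + (N1 * (1 / M1) + (N2 * (1 / Mb) + N3 * (1 / (M1 * M * Mb)))) := by
  classical
  obtain ⟨cb, f, hcf⟩ := cover (M := M) P hP hP1 κ hκ hκ1 htot lam hl hl1 T η τ Γ hτ0 hτ1 hΓ (by
    refine le_trans (le_of_eq ?_) hη
    refine Finset.sum_congr rfl fun a _ => Finset.sum_congr rfl fun b _ => Finset.sum_congr rfl fun c _ =>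
      Finset.sum_congr rfl fun v _ => ?_
    by_cases h : T a b c v <;> simp [h, ind]) hT
  obtain ⟨h1, s, hb, hh⟩ := hashing (M1 := M1) (Mb := Mb) P hP hP1 T N1 N2 N3 hN1 hN2 hN3 cb f
  obtain ⟨a0⟩ := ‹Nonempty A›
  obtain ⟨b0⟩ := ‹Nonempty B›
  set enc2 : B → A → Fin M × Fin Mb := fun b a => (f a b + s a, hb (a, b)) with henc
  set S2 : B → Fin M1 → A → Prop := fun b j a => (∃ c v, T a b c v) ∧ h1 a = j with hS2
  set dec2 : B → Fin M1 → A := fun b j => if h : ∃ a, S2 b j a then h.choose else a0 with hdec2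
  set dec1 : A → Fin M × Fin Mb → V := fun a j => cb a (j.1 - s a) with hdec1
  set S3 : C → Fin M1 → Fin M × Fin Mb → A × B → Prop := fun c j k ab =>
    T ab.1 ab.2 c (cb ab.1 (f ab.1 ab.2)) ∧ h1 ab.1 = j ∧ enc2 ab.2 ab.1 = k with hS3
  set pick : C → Fin M1 → Fin M × Fin Mb → A × B := fun c j k =>
    if h : ∃ ab, S3 c j k ab then h.choose else (a0, b0) with hpick
  set dec3 : C → Fin M1 → Fin M × Fin Mb → A × B × V := fun c j k =>
    ((pick c j k).1, (pick c j k).2, cb (pick c j k).1 (f (pick c j k).1 (pick c j k).2)) with hdec3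
  refine ⟨h1, dec2, enc2, dec1, dec3, ?_⟩
  refine le_trans ?_ (add_le_add hcf hh)
  simp only [← Finset.sum_add_distrib]
  refine Finset.sum_le_sum fun a _ => Finset.sum_le_sum fun b _ => Finset.sum_le_sum fun c _ => ?_
  have e0 : (if T a b c (cb a (f a b)) then 0 else P a b c) = P a b c * ind (¬ T a b c (cb a (f a b))) := by
    by_cases h : T a b c (cb a (f a b)) <;> simp [h, ind]
  rw [e0, ← mul_add]
  refine mul_le_mul_of_nonneg_left ?_ (hP a b c)
  refine le_trans ?_ (add_le_add le_rfl (ind_or _ _))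
  refine le_trans (ind_mono ?_) (ind_or _ _)
  intro hbad
  by_contra hcon
  push Not at hcon
  obtain ⟨hT0, hn1, hn2⟩ := hcon
  refine hbad ⟨cb a (f a b), hT0, ?_, ?_, ?_⟩
  · have hex : ∃ a', S2 b (h1 a) a' := ⟨a, ⟨c, _, hT0⟩, rfl⟩
    have hsp := hex.choose_spec
    simp only [hdec2, dif_pos hex]
    by_contra hne
    exact hn1 ⟨_, hsp.1, hne, hsp.2⟩
  · simp only [hdec1, henc, add_sub_cancel_right]
  · have hex : ∃ ab, S3 c (h1 a) (enc2 b a) ab := ⟨(a, b), hT0, rfl, rfl⟩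
    have hsp := hex.choose_spec
    have hpk : pick c (h1 a) (enc2 b a) = (a, b) := by
      simp only [hpick, dif_pos hex]
      by_contra hne
      have h3 := hsp.2.2
      simp only [henc, Prod.mk.injEq] at h3
      exact hn2 ⟨_, hsp.1, hne, hsp.2.1, h3.1, h3.2⟩
    simp only [hdec3, hpk]

end TE

namespace TE
section info
variable {Ω : Type*} [Fintype Ω] {α β γ : Type*} [Fintype α] [Fintype β] [Fintype γ]

theorem marg_dist (w : Ω → ℝ) (X : Ω → α) (Y : Ω → β) (b : β) :
    ∑ a, IT.dist w (fun ω => (X ω, Y ω)) (a, b) = IT.dist w Y b := by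
  classical
  unfold IT.dist
  rw [Finset.sum_comm]
  refine Finset.sum_congr rfl fun ω _ => ?_
  by_cases h : Y ω = b <;> simp [h]

/-- conditional pmf -/
def cp (w : Ω → ℝ) (X : Ω → α) (Y : Ω → β) (a : α) (b : β) : ℝ :=
  IT.dist w (fun ω => (X ω, Y ω)) (a, b) / IT.dist w Y b

theorem cp_nonneg {w : Ω → ℝ} (hw : ∀ ω, 0 ≤ w ω) (X : Ω → α) (Y : Ω → β) (a : α) (b : β) : 0 ≤ cp w X Y a b :=
  div_nonneg (dist_nonneg hw _ _) (dist_nonneg hw _ _)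

theorem cp_sum (w : Ω → ℝ) (X : Ω → α) (Y : Ω → β) (b : β) : ∑ a, cp w X Y a b ≤ 1 := by
  unfold cp
  rw [← Finset.sum_div, marg_dist]
  exact div_self_le_one _

theorem cp_pos {w : Ω → ℝ} (hw : ∀ ω, 0 ≤ w ω) (X : Ω → α) (Y : Ω → β) {ω : Ω} (h : 0 < w ω) :
    0 < cp w X Y (X ω) (Y ω) :=
  div_pos (dist_pos hw (fun ω => (X ω, Y ω)) h) (dist_pos hw Y h)

theorem expect_cp {w : Ω → ℝ} (hw : ∀ ω, 0 ≤ w ω) (X : Ω → α) (Y : Ω → β) :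
    ∑ ω, w ω * (-Real.logb 2 (cp w X Y (X ω) (Y ω))) = IT.condH w X Y := by
  unfold IT.condH
  rw [H_eq, H_eq, ← Finset.sum_sub_distrib]
  refine Finset.sum_congr rfl fun ω _ => ?_
  rcases (hw ω).eq_or_lt with h | h
  · simp [← h]
  · unfold cp
    rw [Real.logb_div (dist_pos hw (fun ω => (X ω, Y ω)) h).ne' (dist_pos hw Y h).ne']
    ring

theorem condH_nonneg {w : Ω → ℝ} (hw : ∀ ω, 0 ≤ w ω) (X : Ω → α) (Y : Ω → β) : 0 ≤ IT.condH w X Y := by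
  have := H_mono hw (fun ω => (X ω, Y ω)) Y (fun ω ω' h => (Prod.mk.inj h).2)
  unfold IT.condH; linarith

theorem condMutInfo_nonneg {w : Ω → ℝ} (hw : IsPMF w) (X : Ω → α) (Y : Ω → β) (Z : Ω → γ) :
    0 ≤ IT.condMutInfo w X Y Z := by
  have := condH_le hw X (fun ω => (Y ω, Z ω)) (fun a b => cp w X Z a b.2) (fun _ _ => cp_nonneg hw.1 _ _ _ _)
    (fun _ => cp_sum _ _ _ _) (fun ω h => cp_pos hw.1 X Z h)
  rw [expect_cp hw.1] at this
  unfold IT.condMutInfo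
  linarith

theorem gibbs_pt {P R : ℝ} (hP : 0 ≤ P) (hR : 0 ≤ R) (h : 0 < P → 0 < R) :
    0 ≤ R - P - P * Real.log (R / P) ∧ (R - P - P * Real.log (R / P) = 0 → R = P) := by
  rcases hP.eq_or_lt with h0 | h0
  · subst h0; simp [hR]
  have hR' := h h0
  have e : R - P - P * Real.log (R / P) = P * (R / P - 1 - Real.log (R / P)) := by
    field_simp
  rw [e]
  refine ⟨mul_nonneg hP (by linarith [Real.log_le_sub_one_of_pos (div_pos hR' h0)]), fun h1 => ?_⟩
  by_contra hne
  have := Real.log_lt_sub_one_of_pos (div_pos hR' h0) (by rw [ne_eq, div_eq_one_iff_eq h0.ne']; exact hne)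
  have := mul_pos h0 (by linarith : 0 < R / P - 1 - Real.log (R / P))
  linarith

theorem markov_eq {w : Ω → ℝ} (hw : IsPMF w) (X : Ω → α) (Y : Ω → β) (Z : Ω → γ)
    (h : IT.condMutInfo w X Y Z = 0) (x : α) (y : β) (z : γ) :
    IT.dist w (fun ω => (X ω, Y ω, Z ω)) (x, y, z) = IT.dist w (fun ω => (Y ω, Z ω)) (y, z) * cp w X Z x z := by
  set P : α × β × γ → ℝ := IT.dist w (fun ω => (X ω, Y ω, Z ω)) with hP
  set R : α × β × γ → ℝ := fun v => IT.dist w (fun ω => (Y ω, Z ω)) (v.2.1, v.2.2) * cp w X Z v.1 v.2.2 with hR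
  have hP0 : ∀ v, 0 ≤ P v := fun v => dist_nonneg hw.1 _ _
  have hR0 : ∀ v, 0 ≤ R v := fun v => mul_nonneg (dist_nonneg hw.1 _ _) (cp_nonneg hw.1 _ _ _ _)
  have hlow : ∀ v, 0 < P v → ∃ ω, 0 < w ω ∧ (X ω, Y ω, Z ω) = v := by
    intro v hv
    by_contra hcon
    push Not at hcon
    refine hv.ne' ?_
    rw [hP]; unfold IT.dist
    refine Finset.sum_eq_zero fun ω _ => ?_
    split_ifs with he
    · rcases (hw.1 ω).eq_or_lt with h0 | h0
      · exact h0.symm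
      · exact absurd he (hcon ω h0)
    · rfl
  have hPR : ∀ v, 0 < P v → 0 < R v := by
    intro v hv
    obtain ⟨ω, hω, rfl⟩ := hlow v hv
    exact mul_pos (dist_pos hw.1 (fun ω => (Y ω, Z ω)) hω) (cp_pos hw.1 X Z hω)
  have hPs : ∑ v, P v = 1 := by rw [hP, sum_dist, hw.2]
  have hRs : ∑ v, R v ≤ 1 := by
    rw [Fintype.sum_prod_type, Finset.sum_comm]
    rw [← hw.2, ← sum_dist w (fun ω => (Y ω, Z ω))]
    refine Finset.sum_le_sum fun yz _ => ?_
    simp only [hR, ← Finset.mul_sum]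
    exact mul_le_of_le_one_right (dist_nonneg hw.1 _ _) (cp_sum _ _ _ _)
  have hlog : ∑ v, P v * Real.log (R v / P v) = 0 := by
    rw [hP, sum_dist_mul w _ (fun v => Real.log (R v / P v))]
    have e1 := expect_cp hw.1 X Z
    have e2 := expect_cp hw.1 X (fun ω => (Y ω, Z ω))
    unfold IT.condMutInfo at h
    rw [← e1, ← e2, ← Finset.sum_sub_distrib] at h
    have e3 : ∑ ω, w ω * Real.log (R (X ω, Y ω, Z ω) / P (X ω, Y ω, Z ω)) =
        -(Real.log 2) * ∑ ω, (w ω * -Real.logb 2 (cp w X Z (X ω) (Z ω)) -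
          w ω * -Real.logb 2 (cp w X (fun ω => (Y ω, Z ω)) (X ω) (Y ω, Z ω))) := by
      rw [Finset.mul_sum]
      refine Finset.sum_congr rfl fun ω _ => ?_
      rcases (hw.1 ω).eq_or_lt with h0 | h0
      · simp [← h0]
      have p1 := cp_pos hw.1 X Z h0
      have p2 := dist_pos hw.1 (fun ω => (Y ω, Z ω)) h0
      have p3 := dist_pos hw.1 (fun ω => (X ω, Y ω, Z ω)) h0
      simp only [hR]
      conv_rhs => unfold Real.logb
      rw [show cp w X (fun ω => (Y ω, Z ω)) (X ω) (Y ω, Z ω) = P (X ω, Y ω, Z ω) / IT.dist w (fun ω => (Y ω, Z ω)) (Y ω, Z ω) from rfl]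
      rw [Real.log_div (mul_pos p2 p1).ne' p3.ne', Real.log_mul p2.ne' p1.ne', Real.log_div p3.ne' p2.ne']
      have : Real.log 2 ≠ 0 := by positivity
      field_simp
      ring
    rw [e3, h, mul_zero]
  have hsum : ∑ v, (R v - P v - P v * Real.log (R v / P v)) ≤ 0 := by
    simp only [Finset.sum_sub_distrib, hlog, hPs]; linarith
  have hnn : ∀ v ∈ Finset.univ, 0 ≤ R v - P v - P v * Real.log (R v / P v) := fun v _ =>
    (gibbs_pt (hP0 v) (hR0 v) (hPR v)).1
  have h0 := (Finset.sum_eq_zero_iff_of_nonneg hnn).1 (le_antisymm hsum (Finset.sum_nonneg hnn))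
  exact ((gibbs_pt (hP0 _) (hR0 _) (hPR _)).2 (h0 (x, y, z) (Finset.mem_univ _))).symm

/-- counting -/
theorem count_le {α β : Type*} [Fintype α] {n : ℕ} (K : α → β → ℝ) (hK : ∀ a b, 0 ≤ K a b) (hK1 : ∀ b, ∑ a, K a b ≤ 1)
    (y : Fin n → β) (S : (Fin n → α) → Prop) {L : ℝ} (hL : 0 < L)
    (hS : ∀ x, S x → L⁻¹ ≤ ∏ t, K (x t) (y t)) : ∑ x, ind (S x) ≤ L := by
  have h1 : ∑ x : Fin n → α, ∏ t, K (x t) (y t) ≤ 1 := by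
    rw [sum_prod_pi (fun t a => K a (y t))]
    exact Finset.prod_le_one (fun t _ => Finset.sum_nonneg fun a _ => hK _ _) fun t _ => hK1 _
  have h2 : ∑ x, ind (S x) * L⁻¹ ≤ 1 := by
    refine le_trans (Finset.sum_le_sum fun x _ => ?_) h1
    by_cases h : S x
    · rw [ind_pos h, one_mul]; exact hS x h
    · rw [ind_neg h, zero_mul]; exact Finset.prod_nonneg fun t _ => hK _ _
  rw [← Finset.sum_mul, ← div_eq_mul_inv, div_le_one hL] at h2
  exact h2

theorem prod_ge {n : ℕ} (k : Fin n → ℝ) (hk : ∀ t, 0 < k t) {r : ℝ} (h : ∑ t, -Real.logb 2 (k t) ≤ r) :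
    ((2:ℝ) ^ r)⁻¹ ≤ ∏ t, k t := by
  rw [← Real.rpow_neg (by norm_num), Real.rpow_le_iff_le_log (by norm_num) (Finset.prod_pos fun t _ => hk t),
    Real.log_prod (fun t _ => (hk t).ne')]
  have h2 : (0:ℝ) < Real.log 2 := Real.log_pos (by norm_num)
  have : ∑ t, -Real.logb 2 (k t) = -(∑ t, Real.log (k t)) / Real.log 2 := by
    unfold Real.logb
    rw [Finset.sum_neg_distrib, ← Finset.sum_div, neg_div]
  rw [this, div_le_iff₀ h2] at h
  linarith

end info

section chernoff
variable {Ω : Type*} [Fintype Ω]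

theorem mgf_lt_one {q : Ω → ℝ} (hq : IsPMF q) (g : Ω → ℝ) (hg : ∑ ω, q ω * g ω < 0) :
    ∃ l > 0, ∑ ω, q ω * Real.exp (l * g ω) < 1 := by
  set m := -∑ ω, q ω * g ω with hm
  set B := 1 + ∑ ω, |g ω| with hB
  have hm0 : 0 < m := by linarith
  have hgB : ∀ ω, |g ω| ≤ B := by
    intro ω
    have := Finset.single_le_sum (f := fun ω => |g ω|) (fun i _ => abs_nonneg _) (Finset.mem_univ ω)
    linarith
  have hB1 : 1 ≤ B := by
    have := Finset.sum_nonneg (s := Finset.univ) (f := fun ω => |g ω|) (fun i _ => abs_nonneg _)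
    linarith
  set l := min (1 / B) (m / (2 * B ^ 2)) with hl
  have hl0 : 0 < l := lt_min (by positivity) (by positivity)
  refine ⟨l, hl0, ?_⟩
  have hl1 : l * B ≤ 1 := by
    have := min_le_left (1 / B) (m / (2 * B ^ 2))
    rw [← hl, le_div_iff₀ (by positivity)] at this; exact this
  have hl2 : l * (2 * B ^ 2) ≤ m := by
    have := min_le_right (1 / B) (m / (2 * B ^ 2))
    rw [← hl, le_div_iff₀ (by positivity)] at this; exact this
  have hpt : ∀ ω, Real.exp (l * g ω) ≤ 1 + l * g ω + l ^ 2 * B ^ 2 := by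
    intro ω
    have h1 : |l * g ω| ≤ 1 := by
      rw [abs_mul, abs_of_pos hl0]
      exact (mul_le_mul_of_nonneg_left (hgB ω) hl0.le).trans hl1
    have h2 := Real.abs_exp_sub_one_sub_id_le h1
    have h3 := le_of_abs_le h2
    have h4 : (l * g ω) ^ 2 ≤ l ^ 2 * B ^ 2 := by
      rw [mul_pow]
      refine mul_le_mul_of_nonneg_left ?_ (by positivity)
      rw [← sq_abs]
      exact pow_le_pow_left₀ (abs_nonneg _) (hgB ω) 2
    linarith
  calc _ ≤ ∑ ω, q ω * (1 + l * g ω + l ^ 2 * B ^ 2) :=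
        Finset.sum_le_sum fun ω _ => mul_le_mul_of_nonneg_left (hpt ω) (hq.1 ω)
    _ = 1 - l * m + l ^ 2 * B ^ 2 := by
        have : ∀ ω, q ω * (1 + l * g ω + l ^ 2 * B ^ 2) = q ω * (1 + l ^ 2 * B ^ 2) + l * (q ω * g ω) := fun ω => by ring
        simp only [this, Finset.sum_add_distrib, ← Finset.mul_sum, ← Finset.sum_mul, hq.2]
        rw [hm]; ring
    _ < 1 := by nlinarith

theorem chernoff {q : Ω → ℝ} (hq : IsPMF q) (F : Ω → ℝ) {δ : ℝ} (hδ : 0 < δ) :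
    ∃ r : ℝ, 0 ≤ r ∧ r < 1 ∧ ∀ n : ℕ, ∑ x, iidW q n x * ind (¬ ∑ t, F (x t) ≤ n * ((∑ ω, q ω * F ω) + δ)) ≤ r ^ n := by
  set E := ∑ ω, q ω * F ω
  obtain ⟨l, hl, hlt⟩ := mgf_lt_one hq (fun ω => F ω - (E + δ)) (by
    simp only [mul_sub, Finset.sum_sub_distrib, ← Finset.sum_mul, hq.2]
    linarith)
  refine ⟨_, Finset.sum_nonneg fun ω _ => mul_nonneg (hq.1 ω) (Real.exp_pos _).le, hlt, fun n => ?_⟩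
  have e : (∑ ω, q ω * Real.exp (l * (F ω - (E + δ)))) ^ n =
      ∑ x : Fin n → Ω, ∏ t, q (x t) * Real.exp (l * (F (x t) - (E + δ))) := by
    rw [sum_prod_pi (fun _ ω => q ω * Real.exp (l * (F ω - (E + δ))))]; simp
  rw [e]
  refine Finset.sum_le_sum fun x _ => ?_
  rw [Finset.prod_mul_distrib]
  refine mul_le_mul_of_nonneg_left ?_ (Finset.prod_nonneg fun t _ => hq.1 _)
  by_cases h : ∑ t, F (x t) ≤ n * (E + δ)
  · rw [ind_neg (not_not.2 h)]; exact Finset.prod_nonneg fun t _ => (Real.exp_pos _).le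
  · rw [ind_pos h, ← Real.exp_sum, Real.one_le_exp_iff, ← Finset.mul_sum, Finset.sum_sub_distrib]
    push Not at h
    simp only [Finset.sum_const, Finset.card_univ, Fintype.card_fin, nsmul_eq_mul]
    exact mul_nonneg hl.le (by linarith)

end chernoff
end TE

namespace TE
section gen
variable {Ω : Type*} [Fintype Ω]

/-- one-sided typicality -/
def Typ {k : ℕ} (q : Ω → ℝ) (F : Fin k → Ω → ℝ) (δ : ℝ) (n : ℕ) (x : Fin n → Ω) : Prop :=
  (∀ t, 0 < q (x t)) ∧ ∀ j, ∑ t, F j (x t) ≤ n * ((∑ ω, q ω * F j ω) + δ)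

theorem typ_prob {k : ℕ} {q : Ω → ℝ} (hq : IsPMF q) (F : Fin k → Ω → ℝ) {δ : ℝ} (hδ : 0 < δ) :
    ∃ η : ℕ → ℝ, Filter.Tendsto η Filter.atTop (nhds 0) ∧
      ∀ n, ∑ x, ind (¬ Typ q F δ n x) * iidW q n x ≤ η n := by
  choose r hr0 hr1 hr using fun j => chernoff hq (F j) hδ
  refine ⟨fun n => ∑ j, r j ^ n, ?_, fun n => ?_⟩
  · have := tendsto_finset_sum (Finset.univ : Finset (Fin k)) fun j _ =>
      tendsto_pow_atTop_nhds_zero_of_lt_one (hr0 j) (hr1 j)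
    simpa using this
  · refine le_trans ?_ (Finset.sum_le_sum fun j _ => hr j n)
    rw [Finset.sum_comm]
    refine Finset.sum_le_sum fun x _ => ?_
    rw [← Finset.mul_sum, mul_comm]
    by_cases hz : ∀ t, 0 < q (x t)
    · refine mul_le_mul_of_nonneg_left ?_ ((iid_pmf hq n).1 x)
      refine (ind_mono fun h => ?_).trans (ind_exists _)
      by_contra hcon
      push Not at hcon
      exact h ⟨hz, hcon⟩
    · push Not at hz
      obtain ⟨t, ht⟩ := hz
      have : iidW q n x = 0 := Finset.prod_eq_zero (Finset.mem_univ t) (le_antisymm ht (hq.1 _))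
      simp [this]

theorem sum_arrow_prod {α β : Type*} [Fintype α] [Fintype β] {n : ℕ} (φ : (Fin n → α × β) → ℝ) :
    ∑ x, φ x = ∑ a : Fin n → α, ∑ b : Fin n → β, φ (fun t => (a t, b t)) := by
  rw [← Fintype.sum_prod_type']
  exact Fintype.sum_equiv (Equiv.arrowProdEquivProdArrow (Fin n) (fun _ => α) (fun _ => β)) _ _ (fun x => rfl)

theorem dist_congr {α β : Type*} [Fintype α] [Fintype β] (w : Ω → ℝ) (X : Ω → α) (Y : Ω → β) (a : α) (b : β)
    (h : ∀ ω, X ω = a ↔ Y ω = b) : IT.dist w X a = IT.dist w Y b := by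
  unfold IT.dist
  refine Finset.sum_congr rfl fun ω _ => ?_
  by_cases hx : X ω = a
  · rw [if_pos hx, if_pos ((h ω).1 hx)]
  · rw [if_neg hx, if_neg (fun hy => hx ((h ω).2 hy))]
end gen

section main
variable {X1 X2 X3 Xh1 Xh2 : Type} [Fintype X1] [Fintype X2] [Fintype X3] {u : ℕ}

/-- the six single-letter functions -/
def Ff (q : X1 × X2 × X3 × Fin u → ℝ) (d1 : X1 → Xh1 → ℝ) (d2 : X2 → Xh2 → ℝ)
    (g31 : X2 → X3 → Fin u → Xh1) (g12 : X1 → Fin u → Xh2) : Fin 6 → X1 × X2 × X3 × Fin u → ℝ :=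
  ![fun v => -Real.logb 2 (cp q (fun v => v.1) (fun v => v.2.1) v.1 v.2.1),
    fun v => -Real.logb 2 (cp q (fun v => v.2.2.2) (fun v => v.1) v.2.2.2 v.1 /
      cp q (fun v => v.2.2.2) (fun v => (v.2.1, v.1)) v.2.2.2 (v.2.1, v.1)),
    fun v => -Real.logb 2 (cp q (fun v => v.2.1) (fun v => (v.2.2.2, v.1, v.2.2.1)) v.2.1 (v.2.2.2, v.1, v.2.2.1)),
    fun v => -Real.logb 2 (cp q (fun v => (v.1, v.2.1)) (fun v => v.2.2.1) (v.1, v.2.1) v.2.2.1),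
    fun v => d1 v.1 (g31 v.2.1 v.2.2.1 v.2.2.2),
    fun v => d2 v.2.1 (g12 v.1 v.2.2.2)]

theorem F2_expect {q : X1 × X2 × X3 × Fin u → ℝ} (hq : IsPMF q) :
    ∑ v, q v * (-Real.logb 2 (cp q (fun v => v.2.2.2) (fun v => v.1) v.2.2.2 v.1 /
      cp q (fun v => v.2.2.2) (fun v => (v.2.1, v.1)) v.2.2.2 (v.2.1, v.1))) =
    IT.condMutInfo q (fun v => v.2.2.2) (fun v => v.2.1) (fun v => v.1) := by
  unfold IT.condMutInfo
  rw [← expect_cp hq.1, ← expect_cp hq.1, ← Finset.sum_sub_distrib]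
  refine Finset.sum_congr rfl fun v _ => ?_
  rcases (hq.1 v).eq_or_lt with h | h
  · simp [← h]
  · rw [Real.logb_div (cp_pos hq.1 (fun v => v.2.2.2) (fun v => v.1) h).ne'
      (cp_pos hq.1 (fun v => v.2.2.2) (fun v => (v.2.1, v.1)) h).ne']
    ring

theorem q_factor {p : X1 × X2 × X3 → ℝ} {q : X1 × X2 × X3 × Fin u → ℝ} (hq : IsPMF q)
    (hmarg : ∀ a b c, (∑ d : Fin u, q (a, b, c, d)) = p (a, b, c))
    (hM : IT.condMutInfo q (fun v => v.2.2.2) (fun v => v.2.2.1) (fun v => (v.1, v.2.1)) = 0)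
    (a : X1) (b : X2) (c : X3) (i : Fin u) :
    q (a, b, c, i) = p (a, b, c) * cp q (fun v => v.2.2.2) (fun v => (v.2.1, v.1)) i (b, a) := by
  classical
  have h := markov_eq hq _ _ _ hM i c (a, b)
  have e1 : ∀ j, IT.dist q (fun v => (v.2.2.2, v.2.2.1, (v.1, v.2.1))) (j, c, (a, b)) = q (a, b, c, j) := by
    intro j
    unfold IT.dist
    rw [Finset.sum_eq_single (a, b, c, j)]
    · simp
    · rintro ⟨a', b', c', i'⟩ _ h'
      rw [if_neg]
      intro h
      simp only [Prod.mk.injEq, ne_eq] at h h'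
      tauto
    · simp
  have e2 : IT.dist q (fun v => (v.2.2.1, (v.1, v.2.1))) (c, (a, b)) = p (a, b, c) := by
    rw [← hmarg, ← marg_dist q (fun v => v.2.2.2)]
    exact Finset.sum_congr rfl fun j _ => e1 j
  have e3 : cp q (fun v => v.2.2.2) (fun v => (v.1, v.2.1)) i (a, b) =
      cp q (fun v => v.2.2.2) (fun v => (v.2.1, v.1)) i (b, a) := by
    unfold cp
    congr 1
    · exact dist_congr _ _ _ _ _ fun ω => by simp only [Prod.mk.injEq]; tauto
    · exact dist_congr _ _ _ _ _ fun ω => by simp only [Prod.mk.injEq]; tauto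
  rw [e1, e2, e3] at h
  exact h

set_option maxHeartbeats 400000 in
theorem ncode [Nonempty X1] [Nonempty X2] {p : X1 × X2 × X3 → ℝ} (hp : IsPMF p)
    {q : X1 × X2 × X3 × Fin u → ℝ} (hq : IsPMF q)
    (hmarg : ∀ a b c, (∑ d : Fin u, q (a, b, c, d)) = p (a, b, c))
    (hM : IT.condMutInfo q (fun v => v.2.2.2) (fun v => v.2.2.1) (fun v => (v.1, v.2.1)) = 0)
    (d1 : X1 → Xh1 → ℝ) (d2 : X2 → Xh2 → ℝ)
    (g31 : X2 → X3 → Fin u → Xh1) (g12 : X1 → Fin u → Xh2) {δ τ η : ℝ} (hτ0 : 0 < τ) (hτ1 : τ < 1)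
    (n : ℕ) (hη : ∑ x, ind (¬ Typ q (Ff q d1 d2 g31 g12) δ n x) * iidW q n x ≤ η)
    (M1 M Mb : ℕ) [NeZero M1] [NeZero M] [NeZero Mb] :
    ∃ (h1 : (Fin n → X1) → Fin M1) (dec2 : (Fin n → X2) → Fin M1 → (Fin n → X1))
      (enc2 : (Fin n → X2) → (Fin n → X1) → Fin M × Fin Mb)
      (dec1 : (Fin n → X1) → Fin M × Fin Mb → (Fin n → Fin u))
      (dec3 : (Fin n → X3) → Fin M1 → Fin M × Fin Mb → (Fin n → X1) × (Fin n → X2) × (Fin n → Fin u)),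
      ∑ a, ∑ b, ∑ c, iidW p n (fun t => (a t, b t, c t)) *
        ind (¬ ∃ v, Typ q (Ff q d1 d2 g31 g12) δ n (fun t => (a t, b t, c t, v t)) ∧
          dec2 b (h1 a) = a ∧ dec1 a (enc2 b a) = v ∧ dec3 c (h1 a) (enc2 b a) = (a, b, v)) ≤
      η / τ + τ + Real.exp (-(M / (2:ℝ) ^ (n * (IT.condMutInfo q (fun v => v.2.2.2) (fun v => v.2.1) (fun v => v.1) + δ)))) +
      ((2:ℝ) ^ (n * (IT.condH q (fun v => v.1) (fun v => v.2.1) + δ)) * (1 / M1) +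
      ((2:ℝ) ^ (n * (IT.condH q (fun v => v.2.1) (fun v => (v.2.2.2, v.1, v.2.2.1)) + δ)) * (1 / Mb) +
       (2:ℝ) ^ (n * (IT.condH q (fun v => (v.1, v.2.1)) (fun v => v.2.2.1) + δ)) * (1 / (M1 * M * Mb)))) := by
  classical
  have hne : Nonempty (Fin u) := by
    by_contra hcon
    rw [not_nonempty_iff] at hcon
    have := hq.2
    simp at this
  set F := Ff q d1 d2 g31 g12 with hF
  have hfac : ∀ (a : Fin n → X1) (b : Fin n → X2) (c : Fin n → X3) (v : Fin n → Fin u),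
      iidW p n (fun t => (a t, b t, c t)) *
        ∏ t, cp q (fun v => v.2.2.2) (fun v => (v.2.1, v.1)) (v t) (b t, a t) = iidW q n (fun t => (a t, b t, c t, v t)) := by
    intro a b c v
    unfold iidW
    rw [← Finset.prod_mul_distrib]
    exact Finset.prod_congr rfl fun t _ => (q_factor hq hmarg hM _ _ _ _).symm
  have s3 : ∀ φ : (Fin n → X1 × X2 × X3) → ℝ, ∑ x, φ x = ∑ a : Fin n → X1, ∑ b : Fin n → X2, ∑ c : Fin n → X3,
      φ (fun t => (a t, b t, c t)) := by
    intro φ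
    rw [sum_arrow_prod]
    refine Finset.sum_congr rfl fun a _ => ?_
    rw [sum_arrow_prod (fun bc : Fin n → X2 × X3 => φ (fun t => (a t, bc t)))]
  have s4 : ∀ φ : (Fin n → X1 × X2 × X3 × Fin u) → ℝ, ∑ x, φ x = ∑ a : Fin n → X1, ∑ b : Fin n → X2, ∑ c : Fin n → X3,
      ∑ v : Fin n → Fin u, φ (fun t => (a t, b t, c t, v t)) := by
    intro φ
    rw [sum_arrow_prod]
    refine Finset.sum_congr rfl fun a _ => ?_
    rw [sum_arrow_prod (fun bc : Fin n → X2 × X3 × Fin u => φ (fun t => (a t, bc t)))]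
    refine Finset.sum_congr rfl fun b _ => ?_
    rw [sum_arrow_prod (fun bc : Fin n → X3 × Fin u => φ (fun t => (a t, b t, bc t)))]
  let P : (Fin n → X1) → (Fin n → X2) → (Fin n → X3) → ℝ := fun a b c => iidW p n (fun t => (a t, b t, c t))
  let κ : (Fin n → X1) → (Fin n → X2) → (Fin n → Fin u) → ℝ :=
    fun a b v => ∏ t, cp q (fun v => v.2.2.2) (fun v => (v.2.1, v.1)) (v t) (b t, a t)
  let lam : (Fin n → X1) → (Fin n → Fin u) → ℝ := fun a v => ∏ t, cp q (fun v => v.2.2.2) (fun v => v.1) (v t) (a t)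
  let T : (Fin n → X1) → (Fin n → X2) → (Fin n → X3) → (Fin n → Fin u) → Prop :=
    fun a b c v => Typ q F δ n (fun t => (a t, b t, c t, v t))
  have hP1 : ∑ a, ∑ b, ∑ c, P a b c = 1 := by
    rw [← (iid_pmf hp n).2, s3]
  have hκ1 : ∀ a b, ∑ v, κ a b v ≤ 1 := by
    intro a b
    show ∑ v : Fin n → Fin u, ∏ t, cp q (fun v => v.2.2.2) (fun v => (v.2.1, v.1)) (v t) (b t, a t) ≤ 1
    rw [sum_prod_pi (fun t i => cp q (fun v => v.2.2.2) (fun v => (v.2.1, v.1)) i (b t, a t))]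
    exact Finset.prod_le_one (fun t _ => Finset.sum_nonneg fun i _ => cp_nonneg hq.1 _ _ _ _) fun t _ => cp_sum _ _ _ _
  have htot : ∑ a, ∑ b, ∑ c, ∑ v, P a b c * κ a b v = 1 := by
    simp only [P, κ, hfac]
    rw [← s4, (iid_pmf hq n).2]
  have hl1 : ∀ a, ∑ v, lam a v ≤ 1 := by
    intro a
    show ∑ v : Fin n → Fin u, ∏ t, cp q (fun v => v.2.2.2) (fun v => v.1) (v t) (a t) ≤ 1
    rw [sum_prod_pi (fun t i => cp q (fun v => v.2.2.2) (fun v => v.1) i (a t))]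
    exact Finset.prod_le_one (fun t _ => Finset.sum_nonneg fun i _ => cp_nonneg hq.1 _ _ _ _) fun t _ => cp_sum _ _ _ _
  have hη' : ∑ a, ∑ b, ∑ c, ∑ v, ind (¬ T a b c v) * (P a b c * κ a b v) ≤ η := by
    simp only [P, κ, T, hfac]
    rw [← s4 (fun x => ind (¬ Typ q F δ n x) * iidW q n x)]
    exact hη
  have hT : ∀ a b c v, T a b c v → κ a b v ≤ ((2:ℝ) ^ (n * (IT.condMutInfo q (fun v => v.2.2.2) (fun v => v.2.1) (fun v => v.1) + δ))) * lam a v := by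
    rintro a b c v ⟨hpos, hT⟩
    have h := hT 1
    have hk1 : ∀ t, 0 < cp q (fun v => v.2.2.2) (fun v => v.1) (v t) (a t) := fun t =>
      cp_pos hq.1 (fun v => v.2.2.2) (fun v => v.1) (hpos t)
    have hk2 : ∀ t, 0 < cp q (fun v => v.2.2.2) (fun v => (v.2.1, v.1)) (v t) (b t, a t) := fun t =>
      cp_pos hq.1 (fun v => v.2.2.2) (fun v => (v.2.1, v.1)) (hpos t)
    simp only [hF, Ff, Matrix.cons_val_one, Matrix.cons_val_zero] at h
    rw [F2_expect hq] at h
    have := prod_ge _ (fun t => div_pos (hk1 t) (hk2 t)) h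
    rw [Finset.prod_div_distrib, inv_le_iff_one_le_mul₀ (by positivity), mul_comm, ← mul_div_assoc,
      one_le_div (Finset.prod_pos fun t _ => hk2 t)] at this
    exact this
  have hN1 : ∀ b, ∑ a, ind (∃ c v, T a b c v) ≤ ((2:ℝ) ^ (n * (IT.condH q (fun v => v.1) (fun v => v.2.1) + δ))) := by
    intro b
    refine count_le (cp q (fun v => v.1) (fun v => v.2.1)) (fun _ _ => cp_nonneg hq.1 _ _ _ _) (fun _ => cp_sum _ _ _ _)
      b _ (Real.rpow_pos_of_pos two_pos _) ?_
    rintro a ⟨c, v, hpos, hT⟩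
    have h := hT 0
    simp only [hF, Ff, Matrix.cons_val_zero] at h
    rw [expect_cp hq.1 (fun v => v.1) (fun v => v.2.1)] at h
    exact prod_ge _ (fun t => cp_pos hq.1 (fun v => v.1) (fun v => v.2.1) (hpos t)) h
  have hN2 : ∀ a c v, ∑ b, ind (T a b c v) ≤ ((2:ℝ) ^ (n * (IT.condH q (fun v => v.2.1) (fun v => (v.2.2.2, v.1, v.2.2.1)) + δ))) := by
    intro a c v
    refine count_le (cp q (fun v => v.2.1) (fun v => (v.2.2.2, v.1, v.2.2.1))) (fun _ _ => cp_nonneg hq.1 _ _ _ _) (fun _ => cp_sum _ _ _ _)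
      (fun t => (v t, a t, c t)) _ (Real.rpow_pos_of_pos two_pos _) ?_
    rintro b ⟨hpos, hT⟩
    have h := hT 2
    simp only [hF, Ff, Matrix.cons_val] at h
    rw [expect_cp hq.1 (fun v => v.2.1) (fun v => (v.2.2.2, v.1, v.2.2.1))] at h
    exact prod_ge _ (fun t => cp_pos hq.1 (fun v => v.2.1) (fun v => (v.2.2.2, v.1, v.2.2.1)) (hpos t)) h
  have hN3 : ∀ c, ∑ ab : (Fin n → X1) × (Fin n → X2), ind (∃ v, T ab.1 ab.2 c v) ≤ ((2:ℝ) ^ (n * (IT.condH q (fun v => (v.1, v.2.1)) (fun v => v.2.2.1) + δ))) := by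
    intro c
    rw [Fintype.sum_prod_type]
    rw [← sum_arrow_prod (fun x : Fin n → X1 × X2 => ind (∃ v : Fin n → Fin u, Typ q F δ n (fun t => ((x t).1, (x t).2, c t, v t))))]
    refine count_le (cp q (fun v => (v.1, v.2.1)) (fun v => v.2.2.1)) (fun _ _ => cp_nonneg hq.1 _ _ _ _) (fun _ => cp_sum _ _ _ _)
      c _ (Real.rpow_pos_of_pos two_pos _) ?_
    rintro x ⟨v, hpos, hT⟩
    have h := hT 3
    simp only [hF, Ff, Matrix.cons_val] at h
    rw [expect_cp hq.1 (fun v => (v.1, v.2.1)) (fun v => v.2.2.1)] at h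
    exact prod_ge _ (fun t => cp_pos hq.1 (fun v => (v.1, v.2.1)) (fun v => v.2.2.1) (hpos t)) h
  exact oneshot (M1 := M1) (M := M) (Mb := Mb) P (fun a b c => (iid_pmf hp n).1 _) hP1 κ
    (fun a b v => Finset.prod_nonneg fun t _ => cp_nonneg hq.1 _ _ _ _) hκ1 htot lam
    (fun a v => Finset.prod_nonneg fun t _ => cp_nonneg hq.1 _ _ _ _) hl1 T η τ
    _ hτ0 hτ1 (Real.rpow_pos_of_pos two_pos _) hη' hT _ _ _ hN1 hN2 hN3
end main
end TE

namespace TE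

theorem ceil_pow {r : ℝ} (hr : 0 ≤ r) : ∃ M : ℕ, 0 < M ∧ (2:ℝ) ^ r ≤ M ∧ Real.logb 2 M ≤ 1 + r := by
  have h1 : (1:ℝ) ≤ 2 ^ r := Real.one_le_rpow (by norm_num) hr
  have h2 : (2:ℝ) ^ r ≤ (⌈(2:ℝ) ^ r⌉₊ : ℕ) := Nat.le_ceil _
  have h3 : 0 < ⌈(2:ℝ) ^ r⌉₊ := Nat.ceil_pos.2 (by linarith)
  refine ⟨⌈(2:ℝ) ^ r⌉₊, h3, h2, ?_⟩
  have h4 : ((⌈(2:ℝ) ^ r⌉₊ : ℕ) : ℝ) ≤ 2 ^ (1 + r) := by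
    rw [Real.rpow_add (by norm_num), Real.rpow_one]
    have := Nat.ceil_lt_add_one (show (0:ℝ) ≤ 2 ^ r by linarith)
    linarith
  rw [Real.logb_le_iff_le_rpow (by norm_num) (by exact_mod_cast h3)]
  exact h4

theorem pow_ratio {a b c M : ℝ} (hM : (2:ℝ) ^ b ≤ M) (h : a + c ≤ b) : (2:ℝ) ^ a * (1 / M) ≤ ((2:ℝ) ^ c)⁻¹ := by
  have hb : (0:ℝ) < 2 ^ b := Real.rpow_pos_of_pos two_pos _
  have hc : (0:ℝ) < 2 ^ c := Real.rpow_pos_of_pos two_pos _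
  rw [mul_one_div, div_le_iff₀ (by linarith), ← div_eq_inv_mul, le_div_iff₀ hc, ← Real.rpow_add two_pos]
  exact (Real.rpow_le_rpow_of_exponent_le (by norm_num) h).trans hM

theorem analytic {I H1 H2 H3 R1 R2 δ ε : ℝ} (hI : 0 ≤ I) (h10 : 0 ≤ H1) (h20 : 0 ≤ H2) (hR1 : H1 ≤ R1)
    (hR2 : I + H2 ≤ R2) (hR3 : H3 ≤ R1 + R2) (hδ : 0 < δ) (hε : 0 < ε) (η : ℕ → ℝ)
    (hη : Filter.Tendsto η Filter.atTop (nhds 0)) :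
    ∃ (n : ℕ) (τ : ℝ) (M1 M Mb : ℕ), 0 < n ∧ 0 < τ ∧ τ < 1 ∧ 0 < M1 ∧ 0 < M ∧ 0 < Mb ∧
      Real.logb 2 M1 ≤ n * (R1 + 3 * δ) ∧ Real.logb 2 ((M * Mb : ℕ) : ℝ) ≤ n * (R2 + 6 * δ) ∧
      η n / τ + τ + Real.exp (-(M / (2:ℝ) ^ (n * (I + δ)))) +
      ((2:ℝ) ^ (n * (H1 + δ)) * (1 / M1) +
      ((2:ℝ) ^ (n * (H2 + δ)) * (1 / Mb) +
       (2:ℝ) ^ (n * (H3 + δ)) * (1 / (M1 * M * Mb)))) ≤ ε := by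
  obtain ⟨τ, hτ0, hτ1, hτ⟩ : ∃ τ : ℝ, 0 < τ ∧ τ < 1 ∧ τ ≤ ε / 4 :=
    ⟨min (1/2) (ε/4), by positivity, lt_of_le_of_lt (min_le_left _ _) (by norm_num), min_le_right _ _⟩
  have hx : Filter.Tendsto (fun n : ℕ => ((2:ℝ) ^ (-δ)) ^ n) Filter.atTop (nhds 0) :=
    tendsto_pow_atTop_nhds_zero_of_lt_one (by positivity)
      (Real.rpow_lt_one_of_one_lt_of_neg (by norm_num) (by linarith))
  have e1 := hη.eventually (gt_mem_nhds (show (0:ℝ) < τ * τ by positivity))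
  have e2 := hx.eventually (gt_mem_nhds (show (0:ℝ) < ε / 8 by positivity))
  obtain ⟨n0, hn0⟩ := exists_nat_gt (1 / δ)
  obtain ⟨n, hn1, hn2, hn3⟩ := (e1.and (e2.and (Filter.eventually_ge_atTop (n0 + 1)))).exists
  have hnn : (1:ℝ) ≤ n * δ := by
    rw [div_lt_iff₀ hδ] at hn0
    have : ((n0 + 1 : ℕ) : ℝ) ≤ n := by exact_mod_cast hn3
    push_cast at this
    nlinarith
  have hn00 : (0:ℝ) ≤ n := Nat.cast_nonneg n
  obtain ⟨M1, hM10, hM1, hM1l⟩ := ceil_pow (r := n * (R1 + 2 * δ)) (mul_nonneg hn00 (by linarith))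
  obtain ⟨M, hM0, hM, hMl⟩ := ceil_pow (r := n * (I + 2 * δ)) (mul_nonneg hn00 (by linarith))
  obtain ⟨Mb, hMb0, hMb, hMbl⟩ := ceil_pow (r := n * (R2 - I + 2 * δ)) (mul_nonneg hn00 (by linarith))
  have hM1p : (0:ℝ) < M1 := by exact_mod_cast hM10
  have hMp : (0:ℝ) < M := by exact_mod_cast hM0
  have hMbp : (0:ℝ) < Mb := by exact_mod_cast hMb0
  have hxe : ((2:ℝ) ^ (n * δ))⁻¹ = ((2:ℝ) ^ (-δ)) ^ n := by
    rw [← Real.rpow_natCast, ← Real.rpow_mul (by norm_num), ← Real.rpow_neg (by norm_num)]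
    congr 1; ring
  have hxp : (0:ℝ) < 2 ^ (n * δ) := Real.rpow_pos_of_pos two_pos _
  refine ⟨n, τ, M1, M, Mb, by omega, hτ0, hτ1, hM10, hM0, hMb0, by nlinarith, ?_, ?_⟩
  · push_cast
    rw [Real.logb_mul hMp.ne' hMbp.ne']
    nlinarith
  · have t1 : η n / τ ≤ τ := by rw [div_le_iff₀ hτ0]; exact hn1.le
    have t2 : Real.exp (-(M / (2:ℝ) ^ (n * (I + δ)))) ≤ ((2:ℝ) ^ (n * δ))⁻¹ := by
      have : (2:ℝ) ^ (n * δ) ≤ M / (2:ℝ) ^ (n * (I + δ)) := by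
        rw [le_div_iff₀ (Real.rpow_pos_of_pos two_pos _), ← Real.rpow_add two_pos]
        refine le_trans (le_of_eq ?_) hM
        congr 1; ring
      rw [Real.exp_neg]
      refine inv_anti₀ hxp (this.trans ?_)
      linarith [Real.add_one_le_exp (M / (2:ℝ) ^ (n * (I + δ)))]
    have t3 := pow_ratio (a := n * (H1 + δ)) (c := n * δ) hM1 (by nlinarith)
    have t4 := pow_ratio (a := n * (H2 + δ)) (c := n * δ) hMb (by nlinarith)
    have t5 := pow_ratio (a := n * (H3 + δ)) (b := n * (R1 + 2 * δ) + n * (I + 2 * δ) + n * (R2 - I + 2 * δ))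
      (M := M1 * M * Mb) (c := n * δ) (by
        rw [Real.rpow_add two_pos, Real.rpow_add two_pos]
        gcongr) (by nlinarith)
    rw [hxe] at t2 t3 t4 t5
    linarith

section lossy
variable {Ω : Type*} [Fintype Ω]

theorem lossy_bound {n : ℕ} (hn : 0 < n) {w : Ω → ℝ} (hw : IsPMF w) (B : Ω → Prop) {ε D dm : ℝ}
    (hB : ∑ ω, w ω * ind (B ω) ≤ ε) (f : Fin n → Ω → ℝ) (hf : ∀ t ω, f t ω ≤ dm) (hdm : 0 ≤ dm) (hD : 0 ≤ D)
    (hg : ∀ ω, ¬ B ω → ∑ t, f t ω ≤ n * D) :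
    (1 / (n : ℝ)) * ∑ t : Fin n, IT.expect w (f t) ≤ D + dm * ε := by
  have hn' : (0:ℝ) < n := by exact_mod_cast hn
  unfold IT.expect
  rw [Finset.sum_comm]
  have h1 : ∑ ω, ∑ t, w ω * f t ω ≤ ∑ ω, (n * D * w ω + n * dm * (w ω * ind (B ω))) := by
    refine Finset.sum_le_sum fun ω _ => ?_
    rw [← Finset.mul_sum]
    have hw0 := hw.1 ω
    by_cases h : B ω
    · rw [ind_pos h]
      have : ∑ t, f t ω ≤ n * dm := by
        refine (Finset.sum_le_sum fun t _ => hf t ω).trans ?_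
        simp
      have h2 := mul_le_mul_of_nonneg_left this hw0
      have h3 : 0 ≤ n * D * w ω := by positivity
      linarith
    · rw [ind_neg h]
      have h2 := mul_le_mul_of_nonneg_left (hg ω h) hw0
      linarith
  rw [Finset.sum_add_distrib, ← Finset.mul_sum, ← Finset.mul_sum, hw.2] at h1
  have h4 : n * dm * ∑ ω, w ω * ind (B ω) ≤ n * dm * ε := mul_le_mul_of_nonneg_left hB (by positivity)
  rw [one_div, ← div_eq_inv_mul, div_le_iff₀ hn']
  linarith

theorem pr_le {w : Ω → ℝ} (hw : ∀ ω, 0 ≤ w ω) (E B : Ω → Prop) {ε : ℝ}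
    (hB : ∑ ω, w ω * ind (B ω) ≤ ε) (h : ∀ ω, ¬ B ω → ¬ E ω) : IT.pr w E ≤ ε := by
  classical
  refine le_trans ?_ hB
  unfold IT.pr
  refine Finset.sum_le_sum fun ω _ => ?_
  by_cases hE : E ω
  · rw [if_pos hE, ind_pos (by by_contra hb; exact h ω hb hE), mul_one]
  · rw [if_neg hE]
    exact mul_nonneg (hw ω) (ind_nonneg _)
end lossy

theorem exists_max {α β : Type*} [Fintype α] [Fintype β] (d : α → β → ℝ) : ∃ m : ℝ, 0 ≤ m ∧ ∀ a b, d a b ≤ m := by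
  refine ⟨∑ a, ∑ b, |d a b|, by positivity, fun a b => ?_⟩
  refine (le_abs_self _).trans ?_
  refine le_trans (Finset.single_le_sum (f := fun b => |d a b|) (fun b _ => abs_nonneg _) (Finset.mem_univ b)) ?_
  exact Finset.single_le_sum (f := fun a => ∑ b, |d a b|) (fun a _ => by positivity) (Finset.mem_univ a)

theorem achiev {X1 X2 X3 Xh1 Xh2 : Type} [Fintype X1] [Fintype X2] [Fintype X3]
    [Fintype Xh1] [Fintype Xh2] [Nonempty X1] [Nonempty X2]
    {p : X1 × X2 × X3 → ℝ} (hp : IsPMF p)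
    {d1 : X1 → Xh1 → ℝ} (hd1 : ∀ x y, 0 ≤ d1 x y)
    {d2 : X2 → Xh2 → ℝ} (hd2 : ∀ x y, 0 ≤ d2 x y)
    {R1 R2 D12 D31 : ℝ} (h : Single p d1 d2 R1 R2 D12 D31) : Oper p d1 d2 R1 R2 D12 D31 := by
  obtain ⟨u, -, q, hq, hmarg, hM, g31, g12, hD31, hD12, hR1, hR2, hR3⟩ := h
  intro ε hε
  obtain ⟨m1, hm10, hm1⟩ := exists_max d1
  obtain ⟨m2, hm20, hm2⟩ := exists_max d2
  obtain ⟨δ, hδ, hδε⟩ : ∃ δ : ℝ, 0 < δ ∧ 6 * δ ≤ ε := ⟨ε / 6, by positivity, by linarith⟩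
  obtain ⟨ε', hε', hεε, he1, he2⟩ : ∃ ε' : ℝ, 0 < ε' ∧ ε' ≤ ε ∧ m1 * ε' ≤ ε / 2 ∧ m2 * ε' ≤ ε / 2 := by
    refine ⟨ε / (2 * (1 + m1 + m2)), by positivity, ?_, ?_, ?_⟩
    · exact div_le_self hε.le (by linarith)
    · rw [← mul_div_assoc, div_le_div_iff₀ (by positivity) (by positivity)]
      nlinarith [mul_nonneg hε.le hm20]
    · rw [← mul_div_assoc, div_le_div_iff₀ (by positivity) (by positivity)]
      nlinarith [mul_nonneg hε.le hm10]
  obtain ⟨η, hη, hηn⟩ := typ_prob hq (Ff q d1 d2 g31 g12) hδ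
  obtain ⟨n, τ, M1, M, Mb, hn, hτ0, hτ1, hM1, hM0, hMb, hl1, hl2, herr⟩ :=
    analytic (condMutInfo_nonneg hq (fun v => v.2.2.2) (fun v => v.2.1) (fun v => v.1))
      (condH_nonneg hq.1 (fun v => v.1) (fun v => v.2.1))
      (condH_nonneg hq.1 (fun v => v.2.1) (fun v => (v.2.2.2, v.1, v.2.2.1))) hR1 hR2 hR3 hδ hε' η hη
  haveI : NeZero M1 := ⟨hM1.ne'⟩
  haveI : NeZero M := ⟨hM0.ne'⟩
  haveI : NeZero Mb := ⟨hMb.ne'⟩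
  obtain ⟨h1, dec2, enc2, dec1, dec3, hc⟩ := ncode hp hq hmarg hM d1 d2 g31 g12 hτ0 hτ1 n (hηn n) M1 M Mb
  have hc' := hc.trans herr
  clear hc herr
  let B : (Fin n → X1 × X2 × X3) → Prop := fun ω =>
    ¬ ∃ v, Typ q (Ff q d1 d2 g31 g12) δ n (fun t => ((ω t).1, (ω t).2.1, (ω t).2.2, v t)) ∧
      dec2 (fun t => (ω t).2.1) (h1 (fun t => (ω t).1)) = (fun t => (ω t).1) ∧
      dec1 (fun t => (ω t).1) (enc2 (fun t => (ω t).2.1) (fun t => (ω t).1)) = v ∧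
      dec3 (fun t => (ω t).2.2) (h1 (fun t => (ω t).1)) (enc2 (fun t => (ω t).2.1) (fun t => (ω t).1)) =
        (fun t => (ω t).1, fun t => (ω t).2.1, v)
  have hB : ∑ ω, iidW p n ω * ind (B ω) ≤ ε' := by
    refine le_trans (le_of_eq ?_) hc'
    rw [sum_arrow_prod]
    refine Finset.sum_congr rfl fun a _ => ?_
    rw [sum_arrow_prod (fun bc : Fin n → X2 × X3 => iidW p n (fun t => (a t, bc t)) * ind (B (fun t => (a t, bc t))))]
  have hnr : (0:ℝ) < n := by exact_mod_cast hn
  -- encoder of node 2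
  let e2 : (Fin n → X2) → Fin M1 → Fin (M * Mb) := fun b j => finProdFinEquiv (enc2 b (dec2 b j))
  let dd : Fin (M * Mb) → Fin M × Fin Mb := fun j => finProdFinEquiv.symm j
  have hde : ∀ b j, dd (e2 b j) = enc2 b (dec2 b j) := fun b j => Equiv.symm_apply_apply _ _
  have hdE0 : 0 ≤ D12 := le_trans (Finset.sum_nonneg fun v _ => mul_nonneg (hq.1 v) (hd2 _ _)) hD12
  have hdE1 : 0 ≤ D31 := le_trans (Finset.sum_nonneg fun v _ => mul_nonneg (hq.1 v) (hd1 _ _)) hD31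
  refine ⟨n, 1, hn, fun _ => M1, fun _ => M * Mb, fun _ => hM1, fun _ => Nat.mul_pos hM0 hMb,
    fun _ ω => h1 (fun t => (ω t).1), fun _ ω => e2 (fun t => (ω t).2.1) (h1 (fun t => (ω t).1)),
    fun a j t => g12 (a t) (dec1 a (dd (j 0)) t),
    fun b j => dec2 b (j 0),
    fun c i j t => g31 ((dec3 c (i 0) (dd (j 0))).2.1 t) (c t) ((dec3 c (i 0) (dd (j 0))).2.2 t),
    fun c i j => (dec3 c (i 0) (dd (j 0))).2.1,
    fun l => ⟨fun a _ => h1 a, fun ω => rfl⟩,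
    fun l => ⟨fun b i => e2 b (i l le_rfl), fun ω => rfl⟩, ?_, ?_, ?_, ?_, ?_, ?_⟩
  · rw [Fin.sum_univ_one, one_div, ← div_eq_inv_mul, div_le_iff₀ hnr]
    nlinarith
  · rw [Fin.sum_univ_one, one_div, ← div_eq_inv_mul, div_le_iff₀ hnr]
    nlinarith
  · refine (lossy_bound hn (iid_pmf hp n) B hB _ (D := D12 + δ) (dm := m2) (fun t ω => hm2 _ _) hm20 (by linarith) ?_).trans (by linarith)
    intro ω hω
    obtain ⟨v, hT, hd, hdv, hd3⟩ := not_not.1 hω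
    have := hT.2 5
    simp only [Ff, Matrix.cons_val] at this
    simp only [hde, hd, hdv]
    refine this.trans ?_
    refine mul_le_mul_of_nonneg_left ?_ hnr.le
    exact add_le_add hD12 le_rfl
  · refine (pr_le (iid_pmf hp n).1 _ B hB ?_).trans hεε
    intro ω hω
    obtain ⟨v, hT, hd, hdv, hd3⟩ := not_not.1 hω
    exact not_not.2 hd
  · refine (pr_le (iid_pmf hp n).1 _ B hB ?_).trans hεε
    intro ω hω
    obtain ⟨v, hT, hd, hdv, hd3⟩ := not_not.1 hω
    refine not_not.2 ?_
    simp only [hde, hd, hd3]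
  · refine (lossy_bound hn (iid_pmf hp n) B hB _ (D := D31 + δ) (dm := m1) (fun t ω => hm1 _ _) hm10 (by linarith) ?_).trans (by linarith)
    intro ω hω
    obtain ⟨v, hT, hd, hdv, hd3⟩ := not_not.1 hω
    have := hT.2 4
    simp only [Ff, Matrix.cons_val] at this
    simp only [hde, hd, hd3]
    refine this.trans ?_
    refine mul_le_mul_of_nonneg_left ?_ hnr.le
    exact add_le_add hD31 le_rfl
end TE

open IT

/-- **Theorem 4** (two encoders and three decoders, lossless/lossy reconstruction with
reversal delivery and side information).  Node 3 observes `X₃ⁿ` but sends no messages;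
nodes 1 and 2 interact over `K` rounds.  Node 1 must reconstruct `X₂ⁿ` within distortion
`D12`, node 2 must reconstruct `X₁ⁿ` losslessly, and node 3 must reconstruct `X₂ⁿ`
losslessly and `X₁ⁿ` within distortion `D31`. -/
theorem two_encoders_three_decoders_reversal_delivery
    {X1 X2 X3 Xh1 Xh2 : Type} [Fintype X1] [Fintype X2] [Fintype X3]
    [Fintype Xh1] [Fintype Xh2]
    [Nonempty X1] [Nonempty X2] [Nonempty X3] [Nonempty Xh1] [Nonempty Xh2]
    (p : X1 × X2 × X3 → ℝ) (hp : IsPMF p)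
    (d1 : X1 → Xh1 → ℝ) (hd1 : ∀ x y, 0 ≤ d1 x y)
    (d2 : X2 → Xh2 → ℝ) (hd2 : ∀ x y, 0 ≤ d2 x y)
    (R1 R2 D12 D31 : ℝ) :
    (∀ ε > (0 : ℝ), ∃ (n K : ℕ), 0 < n ∧ ∃ m1 m2 : Fin K → ℕ,
      (∀ l, 0 < m1 l) ∧ (∀ l, 0 < m2 l) ∧
      ∃ (J1 : (l : Fin K) → (Fin n → X1 × X2 × X3) → Fin (m1 l))
        (J2 : (l : Fin K) → (Fin n → X1 × X2 × X3) → Fin (m2 l))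
        (g12 : (Fin n → X1) → ((l : Fin K) → Fin (m2 l)) → Fin n → Xh2)
        (g21 : (Fin n → X2) → ((l : Fin K) → Fin (m1 l)) → Fin n → X1)
        (g31 : (Fin n → X3) → ((l : Fin K) → Fin (m1 l)) → ((l : Fin K) → Fin (m2 l)) → Fin n → Xh1)
        (g32 : (Fin n → X3) → ((l : Fin K) → Fin (m1 l)) → ((l : Fin K) → Fin (m2 l)) → Fin n → X2),
        -- encoder causality
        (∀ l : Fin K, ∃ f : (Fin n → X1) →
            ((k : Fin K) → k.val < l.val → Fin (m2 k)) → Fin (m1 l),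
          ∀ ω, J1 l ω = f (fun t => (ω t).1) (fun k _ => J2 k ω)) ∧
        (∀ l : Fin K, ∃ f : (Fin n → X2) →
            ((k : Fin K) → k.val ≤ l.val → Fin (m1 k)) → Fin (m2 l),
          ∀ ω, J2 l ω = f (fun t => (ω t).2.1) (fun k _ => J1 k ω)) ∧
        -- rates
        (1 / (n : ℝ)) * ∑ l, Real.logb 2 (m1 l) ≤ R1 + ε ∧
        (1 / (n : ℝ)) * ∑ l, Real.logb 2 (m2 l) ≤ R2 + ε ∧
        -- node 1 reconstructs X₂ⁿ within distortion D12
        (1 / (n : ℝ)) * ∑ t : Fin n, IT.expect (iidW p n)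
            (fun ω => d2 (ω t).2.1
              (g12 (fun s => (ω s).1) (fun l => J2 l ω) t)) ≤ D12 + ε ∧
        -- node 2 reconstructs X₁ⁿ losslessly
        IT.pr (iidW p n)
          (fun ω => (fun t => g21 (fun s => (ω s).2.1) (fun l => J1 l ω) t) ≠
            fun t => (ω t).1) ≤ ε ∧
        -- node 3 reconstructs X₂ⁿ losslessly
        IT.pr (iidW p n)
          (fun ω => (fun t => g32 (fun s => (ω s).2.2) (fun l => J1 l ω) (fun l => J2 l ω) t) ≠
            fun t => (ω t).2.1) ≤ ε ∧
        -- node 3 reconstructs X₁ⁿ within distortion D31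
        (1 / (n : ℝ)) * ∑ t : Fin n, IT.expect (iidW p n)
            (fun ω => d1 (ω t).1
              (g31 (fun s => (ω s).2.2) (fun l => J1 l ω) (fun l => J2 l ω) t)) ≤ D31 + ε)
    ↔
    (∃ u : ℕ, u ≤ Fintype.card X1 * Fintype.card X2 + 3 ∧
      ∃ q : X1 × X2 × X3 × Fin u → ℝ, IsPMF q ∧
        (∀ a b c, (∑ d : Fin u, q (a, b, c, d)) = p (a, b, c)) ∧
        -- Markov chain U -∘- (X1,X2) -∘- X3
        IT.condMutInfo q (fun v => v.2.2.2) (fun v => v.2.2.1) (fun v => (v.1, v.2.1)) = 0 ∧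
        ∃ (g31 : X2 → X3 → Fin u → Xh1) (g12 : X1 → Fin u → Xh2),
          IT.expect q (fun v => d1 v.1 (g31 v.2.1 v.2.2.1 v.2.2.2)) ≤ D31 ∧
          IT.expect q (fun v => d2 v.2.1 (g12 v.1 v.2.2.2)) ≤ D12 ∧
          IT.condH q (fun v => v.1) (fun v => v.2.1) ≤ R1 ∧
          IT.condMutInfo q (fun v => v.2.2.2) (fun v => v.2.1) (fun v => v.1) +
            IT.condH q (fun v => v.2.1) (fun v => (v.2.2.2, v.1, v.2.2.1)) ≤ R2 ∧
          IT.condH q (fun v => (v.1, v.2.1)) (fun v => v.2.2.1) ≤ R1 + R2) := by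
  exact ⟨TE.converse hp, TE.achiev hp hd1 hd2⟩
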